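/- arXiv:1702.04342 — 6 statements merged into one kernel-verified Lean document; each statement's English description precedes it below -/
import Mathlib

section
/- Fix (h♮, m♮) ∈ ℝ^K × ℝ^N with h♮ ≠ 0 and m♮ ≠ 0. Let B ∈ ℝ^{L×K} and C ∈ ℝ^{L×N} have independent standard Gaussian N(0,1) entries, let y = (Bh♮) ∘ (Cm♮) (entrywise product) and s = sign(Bh♮). If L > 2N + 2K − 3, then with probability at least 1 − exp(−[L − (2N + 2K − 3)]² / (2(L−1))), the pair (h♮·√(‖m♮‖₂/‖h♮‖₂), m♮·√(‖h♮‖₂/‖m♮‖₂)) is the unique minimizer of the BranchHull program (BH). -/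
open MeasureTheory ProbabilityTheory

/-- The product measure on `L × K` real matrices (as functions) with i.i.d. standard
Gaussian `N(0,1)` entries. -/
noncomputable def gaussM (L K : ℕ) : Measure (Fin L → Fin K → ℝ) :=
  Measure.pi fun _ : Fin L => Measure.pi fun _ : Fin K => gaussianReal 0 1

/-- Feasibility for the BranchHull program with data `(B, C, y, s)`:
`sign(yℓ)·(bℓᵀh)·(cℓᵀm) ≥ |yℓ|` and `sℓ·(bℓᵀh) ≥ 0` for all `ℓ`. -/
def BHFeas {L K N : ℕ} (B : Fin L → Fin K → ℝ) (C : Fin L → Fin N → ℝ)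
    (y s : Fin L → ℝ) (h : EuclideanSpace ℝ (Fin K)) (m : EuclideanSpace ℝ (Fin N)) : Prop :=
  ∀ ℓ, Real.sign (y ℓ) * ((∑ i, B ℓ i * h i) * (∑ j, C ℓ j * m j)) ≥ |y ℓ| ∧
    s ℓ * (∑ i, B ℓ i * h i) ≥ 0

/-- `(h₀, m₀)` is the unique minimizer of the BranchHull program: it is feasible and
every other feasible point has strictly larger objective value `‖h‖₂² + ‖m‖₂²`. -/
def BHUniqueMin {L K N : ℕ} (B : Fin L → Fin K → ℝ) (C : Fin L → Fin N → ℝ)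
    (y s : Fin L → ℝ) (h₀ : EuclideanSpace ℝ (Fin K)) (m₀ : EuclideanSpace ℝ (Fin N)) : Prop :=
  BHFeas B C y s h₀ m₀ ∧
    ∀ h m, BHFeas B C y s h m → (h, m) ≠ (h₀, m₀) →
      ‖h₀‖ ^ 2 + ‖m₀‖ ^ 2 < ‖h‖ ^ 2 + ‖m‖ ^ 2

open Module Finset in
/-- The number of sign patterns cut out by finitely many linear functionals is controlled by the
dimension, through the Sauer–Shelah lemma. -/
lemma card_signPattern_le {α V : Type*} [Fintype α] [DecidableEq α] [AddCommGroup V] [Module ℝ V]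
    [FiniteDimensional ℝ V] (φ : α → V →ₗ[ℝ] ℝ) (𝒜 : Finset (Finset α))
    (h𝒜 : ∀ S ∈ 𝒜, ∃ v, ∀ a, 0 < (if a ∈ S then -φ a v else φ a v)) :
    #𝒜 ≤ ∑ k ∈ Iic (finrank ℝ V), (Fintype.card α).choose k := by
  have hvc : 𝒜.vcDim ≤ finrank ℝ V := by
    refine Finset.sup_le fun S hS ↦ ?_
    rw [mem_shatterer] at hS
    by_contra! hlt
    have hdep : ¬ LinearIndependent ℝ (fun a : S ↦ φ a) := by
      intro hli
      have := hli.fintype_card_le_finrank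
      rw [Subspace.dual_finrank_eq] at this
      simp only [Fintype.card_coe] at this
      omega
    obtain ⟨c, hc, i, hi⟩ := Fintype.not_linearIndependent_iff.1 hdep
    classical
    obtain ⟨U, hU, hSU⟩ := hS (filter_subset (fun a ↦ ∃ h : a ∈ S, c ⟨a, h⟩ < 0) S)
    obtain ⟨v, hv⟩ := h𝒜 U hU
    have hmem : ∀ a : S, a.1 ∈ U ↔ c a < 0 := fun a ↦ by
      have := congrArg (a.1 ∈ ·) hSU
      simpa using this
    have hnn : ∀ a : S, 0 ≤ c a * φ a v := fun a ↦ by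
      have h1 := hv a
      simp only [hmem] at h1
      split_ifs at h1 with h2 <;> nlinarith
    have hpos : 0 < c i * φ i v := by
      refine lt_of_le_of_ne (hnn i) (Ne.symm (mul_ne_zero hi ?_))
      have h1 := hv i
      split_ifs at h1 <;> intro h0 <;> simp [h0] at h1
    have hsum : ∑ a : S, c a * φ a v = 0 := by
      simpa using LinearMap.congr_fun hc v
    exact hpos.ne' ((sum_eq_zero_iff_of_nonneg fun a _ ↦ hnn a).1 hsum i (mem_univ _))
  calc #𝒜 ≤ #𝒜.shatterer := card_le_card_shatterer _
    _ ≤ ∑ k ∈ Iic 𝒜.vcDim, (Fintype.card α).choose k := card_shatterer_le_sum_vcDim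
    _ ≤ _ := sum_le_sum_of_subset (Iic_subset_Iic.2 hvc)

open Finset in
/-- Chernoff–Hoeffding bound for the lower tail of a symmetric binomial distribution. -/
lemma sum_choose_Iic_le_exp {L d : ℕ} (hL : 0 < L) (hd : 2 * d ≤ L) :
    (∑ k ∈ Iic d, (L.choose k : ℝ)) ≤ 2 ^ L * Real.exp (-((L : ℝ) - 2 * d) ^ 2 / (2 * L)) := by
  have hL' : (0 : ℝ) < L := by exact_mod_cast hL
  have hd' : 2 * (d : ℝ) ≤ L := by exact_mod_cast hd
  obtain ⟨t, ht⟩ : ∃ t : ℝ, t = ((L : ℝ) - 2 * d) / L := ⟨_, rfl⟩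
  have ht0 : 0 ≤ t := ht ▸ div_nonneg (by linarith) hL'.le
  have hbinom : (∑ k ∈ range (L + 1), (L.choose k : ℝ) * Real.exp (t * (L - 2 * k))) =
      (2 * Real.cosh t) ^ L := by
    have : 2 * Real.cosh t = Real.exp (-t) + Real.exp t := by rw [Real.cosh_eq]; ring
    rw [this, add_pow]
    refine sum_congr rfl fun k hk ↦ ?_
    have hk' : k ≤ L := Nat.lt_succ_iff.1 (mem_range.1 hk)
    rw [← Real.exp_nat_mul, ← Real.exp_nat_mul, ← Real.exp_add, mul_comm]
    congr 2
    push_cast [Nat.cast_sub hk']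
    ring
  have hcosh : (2 * Real.cosh t) ^ L ≤ 2 ^ L * Real.exp (L * (t ^ 2 / 2)) := by
    rw [mul_pow, Real.exp_nat_mul]
    gcongr
    exact Real.cosh_le_exp_half_sq t
  calc (∑ k ∈ Iic d, (L.choose k : ℝ))
      ≤ ∑ k ∈ Iic d, (L.choose k : ℝ) * Real.exp (t * (L - 2 * k)) *
          Real.exp (-(t * (L - 2 * d))) := by
        refine sum_le_sum fun k hk ↦ ?_
        have hk' : (k : ℝ) ≤ d := by exact_mod_cast mem_Iic.1 hk
        rw [mul_assoc, ← Real.exp_add]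
        refine le_mul_of_one_le_right (by positivity) (Real.one_le_exp ?_)
        nlinarith
    _ ≤ ∑ k ∈ range (L + 1), (L.choose k : ℝ) * Real.exp (t * (L - 2 * k)) *
          Real.exp (-(t * (L - 2 * d))) := by
        refine sum_le_sum_of_subset_of_nonneg (fun k hk ↦ ?_) fun _ _ _ ↦ by positivity
        have := mem_Iic.1 hk
        exact mem_range.2 (by omega)
    _ ≤ 2 ^ L * Real.exp (L * (t ^ 2 / 2)) * Real.exp (-(t * (L - 2 * d))) := by
        rw [← sum_mul, hbinom]
        gcongr
    _ = _ := by
        rw [mul_assoc, ← Real.exp_add, ht]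
        congr 2
        field_simp
        ring

open Finset in
/-- Probabilistic form of Wendel's argument: if the linear functionals `φ a ω` can be negated
independently by measure-preserving maps, then the probability that they are simultaneously
positive at some vector is at most a binomial tail. -/
lemma measure_exists_forall_pos_le {α Ω V : Type*} [Fintype α] [DecidableEq α]
    [MeasurableSpace Ω] (μ : Measure Ω) [IsProbabilityMeasure μ]
    [NormedAddCommGroup V] [NormedSpace ℝ V] [FiniteDimensional ℝ V]
    (φ : α → Ω → V →ₗ[ℝ] ℝ) (hφ : ∀ a v, Measurable fun ω ↦ φ a ω v)
    (T : Finset α → Ω → Ω) (hT : ∀ S, MeasurePreserving (T S) μ μ)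
    (hφT : ∀ S a ω, φ a (T S ω) = if a ∈ S then -φ a ω else φ a ω) :
    2 ^ Fintype.card α * μ {ω | ∃ v, ∀ a, 0 < φ a ω v} ≤
      ((∑ k ∈ Iic (Module.finrank ℝ V), (Fintype.card α).choose k : ℕ) : ENNReal) := by
  classical
  set A : Set Ω := {ω | ∃ v, ∀ a, 0 < φ a ω v}
  have hA : MeasurableSet A := by
    obtain ⟨D, hDc, hDd⟩ := TopologicalSpace.exists_countable_dense V
    have : A = ⋃ v ∈ D, {ω | ∀ a, 0 < φ a ω v} := by
      ext ω
      simp only [Set.mem_iUnion, Set.mem_ofPred_eq, exists_prop, A]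
      refine ⟨fun ⟨v, hv⟩ ↦ ?_, fun ⟨v, _, hv⟩ ↦ ⟨v, hv⟩⟩
      have hopen : IsOpen {v | ∀ a, 0 < φ a ω v} := by
        simp only [Set.ofPred_forall]
        exact isOpen_iInter_of_finite fun a ↦
          isOpen_lt continuous_const (φ a ω).continuous_of_finiteDimensional
      obtain ⟨w, hwo, hwD⟩ := hDd.inter_open_nonempty _ hopen ⟨v, hv⟩
      exact ⟨w, hwD, hwo⟩
    rw [this]
    refine MeasurableSet.biUnion hDc fun v _ ↦ ?_
    simp only [Set.ofPred_forall]
    exact MeasurableSet.iInter fun a ↦ measurableSet_lt measurable_const (hφ a v)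
  have hTA : ∀ S, MeasurableSet (T S ⁻¹' A) := fun S ↦ (hT S).measurable hA
  calc 2 ^ Fintype.card α * μ A
      = ∑ S : Finset α, μ (T S ⁻¹' A) := by
        simp [(hT _).measure_preimage hA.nullMeasurableSet]
    _ = ∫⁻ ω, ∑ S : Finset α, (T S ⁻¹' A).indicator 1 ω ∂μ := by
        rw [lintegral_finsetSum _ fun S _ ↦ measurable_one.indicator (hTA S)]
        exact sum_congr rfl fun S _ ↦ (lintegral_indicator_one (hTA S)).symm
    _ ≤ ∫⁻ _, ((∑ k ∈ Iic (Module.finrank ℝ V), (Fintype.card α).choose k : ℕ) : ENNReal) ∂μ := by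
        refine lintegral_mono fun ω ↦ ?_
        have hcard : ∑ S : Finset α, (T S ⁻¹' A).indicator (1 : Ω → ENNReal) ω =
            ((univ.filter fun S ↦ T S ω ∈ A).card : ENNReal) := by
          simp [Set.indicator_apply]
        rw [hcard]
        refine Nat.cast_le.2 (card_signPattern_le (fun a ↦ φ a ω) _ fun S hS ↦ ?_)
        obtain ⟨v, hv⟩ := (mem_filter.1 hS).2
        refine ⟨v, fun a ↦ ?_⟩
        have := hv a
        rw [hφT] at this
        split_ifs at this ⊢ <;> simpa using this
    _ = _ := by simp

open WithLp in
lemma inner_toLp_eq_sum {n : ℕ} (b : Fin n → ℝ) (h : EuclideanSpace ℝ (Fin n)) :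
    inner ℝ h (toLp 2 b) = ∑ i, b i * h i := by
  simp [PiLp.inner_apply]

open WithLp in
lemma measurePreserving_pi_gaussianReal_isometry {n : ℕ}
    (f : EuclideanSpace ℝ (Fin n) ≃ₗᵢ[ℝ] EuclideanSpace ℝ (Fin n)) :
    MeasurePreserving (fun b : Fin n → ℝ ↦ ofLp (f (toLp 2 b)))
      (Measure.pi fun _ ↦ gaussianReal 0 1) (Measure.pi fun _ ↦ gaussianReal 0 1) := by
  have h1 : MeasurePreserving (toLp 2 : (Fin n → ℝ) → EuclideanSpace ℝ (Fin n))
      (Measure.pi fun _ ↦ gaussianReal 0 1) (stdGaussian (EuclideanSpace ℝ (Fin n))) :=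
    ⟨by fun_prop, map_pi_eq_stdGaussian⟩
  have h2 : MeasurePreserving f (stdGaussian (EuclideanSpace ℝ (Fin n)))
      (stdGaussian (EuclideanSpace ℝ (Fin n))) := ⟨by fun_prop, stdGaussian_map f⟩
  have h3 : MeasurePreserving (ofLp : EuclideanSpace ℝ (Fin n) → (Fin n → ℝ))
      (stdGaussian (EuclideanSpace ℝ (Fin n))) (Measure.pi fun _ ↦ gaussianReal 0 1) := by
    refine ⟨by fun_prop, ?_⟩
    rw [← map_pi_eq_stdGaussian, Measure.map_map (by fun_prop) (by fun_prop)]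
    exact Measure.map_id
  exact h3.comp (h2.comp h1)

open WithLp in
lemma ae_pi_gaussianReal_inner_ne_zero {n : ℕ} {h : EuclideanSpace ℝ (Fin n)} (hh : h ≠ 0) :
    ∀ᵐ b ∂(Measure.pi fun _ : Fin n ↦ gaussianReal 0 1), inner ℝ h (toLp 2 b) ≠ 0 := by
  have hmap : (stdGaussian (EuclideanSpace ℝ (Fin n))).map (innerSL ℝ h) =
      gaussianReal 0 (‖h‖ ^ 2).toNNReal := by
    rw [IsGaussian.map_eq_gaussianReal, integral_strongDual_stdGaussian,
      variance_dual_stdGaussian, innerSL_apply_norm]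
  have hv : (‖h‖ ^ 2).toNNReal ≠ 0 := by simpa using hh
  have := nullSingletonClass_gaussianReal (μ := 0) hv
  have hne : ∀ᵐ x ∂(stdGaussian (EuclideanSpace ℝ (Fin n))), innerSL ℝ h x ≠ 0 := by
    refine ae_of_ae_map (p := fun x : ℝ ↦ x ≠ 0) (by fun_prop) ?_
    rw [hmap]
    exact Measure.ae_ne _ _
  rw [← map_pi_eq_stdGaussian] at hne
  exact ae_of_ae_map (f := toLp 2) (p := fun x ↦ innerSL ℝ h x ≠ 0) (by fun_prop) hne

instance isProbabilityMeasure_gaussM (L K : ℕ) : IsProbabilityMeasure (gaussM L K) := by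
  unfold gaussM; infer_instance

open WithLp in
lemma ae_gaussM_inner_ne_zero (L : ℕ) {n : ℕ} {h : EuclideanSpace ℝ (Fin n)} (hh : h ≠ 0) :
    ∀ᵐ B ∂(gaussM L n), ∀ ℓ, inner ℝ h (toLp 2 (B ℓ)) ≠ 0 := by
  refine ae_all_iff.2 fun ℓ ↦ ?_
  exact (measurePreserving_eval (fun _ : Fin L ↦ Measure.pi fun _ : Fin n ↦ gaussianReal 0 1)
    ℓ).quasiMeasurePreserving.ae (ae_pi_gaussianReal_inner_ne_zero hh)

/-- Reflect the rows with index in `S` along `h`. -/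
noncomputable def reflectRows {L n : ℕ} (h : EuclideanSpace ℝ (Fin n)) (S : Finset (Fin L))
    (B : Fin L → Fin n → ℝ) : Fin L → Fin n → ℝ := fun ℓ ↦
  if ℓ ∈ S then WithLp.ofLp ((ℝ ∙ h)ᗮ.reflection (WithLp.toLp 2 (B ℓ))) else B ℓ

lemma measurePreserving_reflectRows {L n : ℕ} (h : EuclideanSpace ℝ (Fin n))
    (S : Finset (Fin L)) : MeasurePreserving (reflectRows h S) (gaussM L n) (gaussM L n) := by
  refine measurePreserving_pi (f := fun ℓ b ↦ if ℓ ∈ S then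
    WithLp.ofLp ((ℝ ∙ h)ᗮ.reflection (WithLp.toLp 2 b)) else b) _ _ fun ℓ ↦ ?_
  by_cases hℓ : ℓ ∈ S
  · simpa only [hℓ, if_true] using measurePreserving_pi_gaussianReal_isometry _
  · simp only [hℓ, if_false]
    exact MeasurePreserving.id _

/-- The functional `u ↦ ⟪u, b⟫ / ⟪h, b⟫` on the orthogonal complement of `h`. -/
noncomputable def ratioFunctional {n : ℕ} (h : EuclideanSpace ℝ (Fin n)) (b : Fin n → ℝ) :
    (ℝ ∙ h)ᗮ →ₗ[ℝ] ℝ :=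
  (inner ℝ h (WithLp.toLp 2 b))⁻¹ • (innerₗ _ (WithLp.toLp 2 b) ∘ₗ (ℝ ∙ h)ᗮ.subtype)

lemma ratioFunctional_apply {n : ℕ} (h : EuclideanSpace ℝ (Fin n)) (b : Fin n → ℝ)
    (u : (ℝ ∙ h)ᗮ) : ratioFunctional h b u =
      inner ℝ (u : EuclideanSpace ℝ (Fin n)) (WithLp.toLp 2 b) / inner ℝ h (WithLp.toLp 2 b) := by
  simp [ratioFunctional, div_eq_inv_mul, real_inner_comm]

lemma measurable_ratioFunctional {n : ℕ} (h : EuclideanSpace ℝ (Fin n)) (u : (ℝ ∙ h)ᗮ) :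
    Measurable fun b ↦ ratioFunctional h b u := by
  simp only [ratioFunctional_apply]
  fun_prop

lemma ratioFunctional_reflectRows {L n : ℕ} (h : EuclideanSpace ℝ (Fin n)) (S : Finset (Fin L))
    (B : Fin L → Fin n → ℝ) (ℓ : Fin L) : ratioFunctional h (reflectRows h S B ℓ) =
      if ℓ ∈ S then -ratioFunctional h (B ℓ) else ratioFunctional h (B ℓ) := by
  by_cases hℓ : ℓ ∈ S
  · ext u
    have hself (x y : EuclideanSpace ℝ (Fin n)) :
        inner ℝ x ((ℝ ∙ h)ᗮ.reflection y) = inner ℝ ((ℝ ∙ h)ᗮ.reflection x) y := by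
      rw [← LinearIsometryEquiv.inner_map_map (ℝ ∙ h)ᗮ.reflection x,
        Submodule.reflection_reflection]
    simp only [hℓ, if_true, reflectRows, LinearMap.neg_apply, ratioFunctional_apply,
      WithLp.toLp_ofLp, hself, Submodule.reflection_orthogonalComplement_singleton_eq_neg,
      Submodule.reflection_mem_subspace_eq_self u.2, inner_neg_left, div_neg]
  · simp [hℓ, reflectRows]

lemma sign_mul_self_eq_abs (x : ℝ) : Real.sign x * x = |x| := by
  rcases lt_trichotomy x 0 with hx | rfl | hx
  · simp [Real.sign_of_neg hx, abs_of_neg hx]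
  · simp
  · simp [Real.sign_of_pos hx, abs_of_pos hx]

/-- A feasible pair has ratios summing to at least two. -/
lemma two_le_div_add_div {x z x₀ z₀ : ℝ} (hx₀ : x₀ ≠ 0) (hz₀ : z₀ ≠ 0)
    (h1 : Real.sign (x₀ * z₀) * (x * z) ≥ |x₀ * z₀|) (h2 : Real.sign x₀ * x ≥ 0) :
    2 ≤ x / x₀ + z / z₀ := by
  have hp : 0 ≤ x / x₀ := by
    rcases lt_or_gt_of_ne hx₀ with h | h
    · rw [Real.sign_of_neg h] at h2
      exact div_nonneg_of_nonpos (by linarith) h.le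
    · rw [Real.sign_of_pos h] at h2
      exact div_nonneg (by linarith) h.le
  have hq : 1 ≤ x / x₀ * (z / z₀) := by
    rw [div_mul_div_comm]
    rcases lt_or_gt_of_ne (mul_ne_zero hx₀ hz₀) with h | h
    · rw [Real.sign_of_neg h, abs_of_neg h] at h1
      rw [one_le_div_of_neg h]; linarith
    · rw [Real.sign_of_pos h, abs_of_pos h] at h1
      rw [one_le_div h]; linarith
  have hq0 : 0 ≤ z / z₀ := by
    by_contra! hneg
    linarith [mul_nonpos_of_nonneg_of_nonpos hp hneg.le]
  nlinarith [sq_nonneg (x / x₀ - z / z₀)]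

/-- The component of `x` orthogonal to `h`. -/
lemma exists_orthogonal_sub_smul {n : ℕ} {h : EuclideanSpace ℝ (Fin n)} (hh : h ≠ 0)
    (x : EuclideanSpace ℝ (Fin n)) :
    ∃ u : (ℝ ∙ h)ᗮ, (u : EuclideanSpace ℝ (Fin n)) = x - (inner ℝ x h / ‖h‖ ^ 2) • h := by
  refine ⟨⟨_, ?_⟩, rfl⟩
  rw [Submodule.mem_orthogonal_singleton_iff_inner_right, inner_sub_right, inner_smul_right,
    real_inner_self_eq_norm_sq, div_mul_cancel₀ _ (by simpa using hh), real_inner_comm, sub_self]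

open WithLp in
/-- Deterministic optimality criterion for BranchHull at a balanced pair. -/
lemma bhUniqueMin_of_not_exists_pos {L K N : ℕ} {B : Fin L → Fin K → ℝ} {C : Fin L → Fin N → ℝ}
    {h₀ : EuclideanSpace ℝ (Fin K)} {m₀ : EuclideanSpace ℝ (Fin N)} (hh : h₀ ≠ 0)
    (hm : m₀ ≠ 0) (hnorm : ‖h₀‖ = ‖m₀‖)
    (hB : ∀ ℓ, inner ℝ h₀ (toLp 2 (B ℓ)) ≠ 0) (hC : ∀ ℓ, inner ℝ m₀ (toLp 2 (C ℓ)) ≠ 0)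
    (hno : ¬ ∃ v : (ℝ ∙ h₀)ᗮ × (ℝ ∙ m₀)ᗮ, ∀ ℓ,
      0 < ratioFunctional h₀ (B ℓ) v.1 + ratioFunctional m₀ (C ℓ) v.2) :
    BHUniqueMin B C (fun ℓ ↦ (∑ i, B ℓ i * h₀ i) * (∑ j, C ℓ j * m₀ j))
      (fun ℓ ↦ Real.sign (∑ i, B ℓ i * h₀ i)) h₀ m₀ := by
  refine ⟨fun ℓ ↦ ⟨(sign_mul_self_eq_abs _).ge, ?_⟩, fun h m hf hne ↦ ?_⟩
  · exact (sign_mul_self_eq_abs _).ge.trans' (abs_nonneg _)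
  by_contra! hle
  refine hno ?_
  obtain ⟨u, hu⟩ := exists_orthogonal_sub_smul hh h
  obtain ⟨v, hv⟩ := exists_orthogonal_sub_smul hm m
  refine ⟨(u, v), fun ℓ ↦ ?_⟩
  have hlt : inner ℝ h h₀ / ‖h₀‖ ^ 2 + inner ℝ m m₀ / ‖m₀‖ ^ 2 < 2 := by
    have hpos : 0 < ‖m₀‖ ^ 2 := by positivity
    rw [hnorm, ← add_div, div_lt_iff₀ hpos]
    have e1 := norm_sub_sq_real h h₀
    have e2 := norm_sub_sq_real m m₀
    have hd : 0 < ‖h - h₀‖ ^ 2 + ‖m - m₀‖ ^ 2 := by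
      by_cases hhh : h = h₀
      · have : m ≠ m₀ := fun hmm ↦ hne (by rw [hhh, hmm])
        have := norm_pos_iff.2 (sub_ne_zero.2 this)
        positivity
      · have := norm_pos_iff.2 (sub_ne_zero.2 hhh)
        positivity
    rw [hnorm] at hle e1
    linarith
  have hge := hf ℓ
  simp only [← inner_toLp_eq_sum] at hge
  have h2 := two_le_div_add_div (hB ℓ) (hC ℓ) hge.1 hge.2
  simp only [ratioFunctional_apply, hu, hv, inner_sub_left, real_inner_smul_left, sub_div,
    mul_div_cancel_right₀ _ (hB ℓ), mul_div_cancel_right₀ _ (hC ℓ)]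
  linarith

lemma ofReal_one_sub_le_measure_of_compl_le {Ω : Type*} [MeasurableSpace Ω] {μ : Measure Ω}
    [IsProbabilityMeasure μ] {S : Set Ω} {x : ℝ} (hx : 0 ≤ x) (hS : μ Sᶜ ≤ ENNReal.ofReal x) :
    ENNReal.ofReal (1 - x) ≤ μ S := by
  rw [ENNReal.ofReal_sub _ hx, ENNReal.ofReal_one, tsub_le_iff_right]
  calc 1 = μ (S ∪ Sᶜ) := by simp
    _ ≤ μ S + μ Sᶜ := measure_union_le _ _
    _ ≤ _ := by gcongr

lemma finrank_orthogonal_span_singleton_add_one {n : ℕ} {h : EuclideanSpace ℝ (Fin n)}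
    (hh : h ≠ 0) : Module.finrank ℝ (ℝ ∙ h)ᗮ + 1 = n := by
  have := (ℝ ∙ h).finrank_add_finrank_orthogonal
  rw [finrank_span_singleton hh, finrank_euclideanSpace_fin] at this
  omega

/-- Probability bound for a balanced pair, in terms of `d = K + N - 2`. -/
lemma measure_compl_bhUniqueMin_le {K N L d : ℕ}
    {h₀ : EuclideanSpace ℝ (Fin K)} {m₀ : EuclideanSpace ℝ (Fin N)}
    (hh : h₀ ≠ 0) (hm : m₀ ≠ 0) (hnorm : ‖h₀‖ = ‖m₀‖) (hd : d + 2 = K + N) (hL : 0 < L)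
    (hdL : 2 * d ≤ L) :
    ((gaussM L K).prod (gaussM L N))
      {p | BHUniqueMin p.1 p.2 (fun ℓ ↦ (∑ i, p.1 ℓ i * h₀ i) * (∑ j, p.2 ℓ j * m₀ j))
        (fun ℓ ↦ Real.sign (∑ i, p.1 ℓ i * h₀ i)) h₀ m₀}ᶜ ≤
      ENNReal.ofReal (Real.exp (-((L : ℝ) - 2 * d) ^ 2 / (2 * L))) := by
  set μ := (gaussM L K).prod (gaussM L N)
  let φ : Fin L → (Fin L → Fin K → ℝ) × (Fin L → Fin N → ℝ) →
      (ℝ ∙ h₀)ᗮ × (ℝ ∙ m₀)ᗮ →ₗ[ℝ] ℝ := fun ℓ p ↦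
    (ratioFunctional h₀ (p.1 ℓ)).coprod (ratioFunctional m₀ (p.2 ℓ))
  have hφ : ∀ ℓ v, Measurable fun p ↦ φ ℓ p v := fun ℓ v ↦
    ((measurable_ratioFunctional h₀ v.1).comp
      ((measurable_pi_apply ℓ).comp measurable_fst)).add
    ((measurable_ratioFunctional m₀ v.2).comp ((measurable_pi_apply ℓ).comp measurable_snd))
  have hwendel := measure_exists_forall_pos_le μ φ hφ
    (fun S ↦ Prod.map (reflectRows h₀ S) (reflectRows m₀ S))
    (fun S ↦ (measurePreserving_reflectRows h₀ S).prod (measurePreserving_reflectRows m₀ S))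
    (fun S ℓ p ↦ by
      simp only [φ, Prod.map_fst, Prod.map_snd, ratioFunctional_reflectRows]
      split_ifs
      · ext <;> simp
      · rfl)
  have hfin : Module.finrank ℝ ((ℝ ∙ h₀)ᗮ × (ℝ ∙ m₀)ᗮ) = d := by
    have h1 := finrank_orthogonal_span_singleton_add_one hh
    have h2 := finrank_orthogonal_span_singleton_add_one hm
    rw [Module.finrank_prod]
    omega
  rw [hfin, Fintype.card_fin] at hwendel
  have hsub : μ {p | BHUniqueMin p.1 p.2
      (fun ℓ ↦ (∑ i, p.1 ℓ i * h₀ i) * (∑ j, p.2 ℓ j * m₀ j))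
      (fun ℓ ↦ Real.sign (∑ i, p.1 ℓ i * h₀ i)) h₀ m₀}ᶜ ≤ μ {p | ∃ v, ∀ ℓ, 0 < φ ℓ p v} := by
    refine measure_mono_ae ?_
    filter_upwards [Measure.quasiMeasurePreserving_fst.ae (ae_gaussM_inner_ne_zero L hh),
      Measure.quasiMeasurePreserving_snd.ae (ae_gaussM_inner_ne_zero L hm)] with p hB hC hp
    by_contra hno
    exact hp (bhUniqueMin_of_not_exists_pos hh hm hnorm hB hC hno)
  refine hsub.trans ?_
  have htail := ENNReal.ofReal_le_ofReal (sum_choose_Iic_le_exp hL hdL)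
  rw [ENNReal.ofReal_mul (by positivity), ENNReal.ofReal_pow (by norm_num),
    ENNReal.ofReal_ofNat, ← Nat.cast_sum, ENNReal.ofReal_natCast] at htail
  exact (ENNReal.mul_le_mul_iff_right (by simp) (by simp)).1 (hwendel.trans htail)

theorem stmt0 {K N L : ℕ}
    (h₀ : EuclideanSpace ℝ (Fin K)) (m₀ : EuclideanSpace ℝ (Fin N))
    (hh : h₀ ≠ 0) (hm : m₀ ≠ 0)
    (hL : 2 * (N : ℝ) + 2 * K - 3 < L) :
    ENNReal.ofReal
        (1 - Real.exp (-((L : ℝ) - (2 * N + 2 * K - 3)) ^ 2 / (2 * ((L : ℝ) - 1)))) ≤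
      (Measure.prod (gaussM L K) (gaussM L N))
        {p | BHUniqueMin p.1 p.2
              (fun ℓ => (∑ i, p.1 ℓ i * h₀ i) * (∑ j, p.2 ℓ j * m₀ j))
              (fun ℓ => Real.sign (∑ i, p.1 ℓ i * h₀ i))
              (Real.sqrt (‖m₀‖ / ‖h₀‖) • h₀) (Real.sqrt (‖h₀‖ / ‖m₀‖) • m₀)} := by
  obtain ⟨K, rfl⟩ : ∃ n, K = n + 1 := Nat.exists_eq_succ_of_ne_zero (by
    rintro rfl; exact hh (Subsingleton.elim _ _))
  obtain ⟨N, rfl⟩ : ∃ n, N = n + 1 := Nat.exists_eq_succ_of_ne_zero (by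
    rintro rfl; exact hm (Subsingleton.elim _ _))
  have hdL : 2 * (K + N) + 1 < L := by
    have : (2 * ((K : ℝ) + N) + 1 : ℝ) < L := by push_cast at hL; linarith
    exact_mod_cast this
  have hL0 : (0 : ℝ) < L - 1 := by
    have : (1 : ℝ) < L := by exact_mod_cast (by omega : 1 < L)
    linarith
  have hnh : 0 < ‖h₀‖ := norm_pos_iff.2 hh
  have hnm : 0 < ‖m₀‖ := norm_pos_iff.2 hm
  obtain ⟨a, ha⟩ : ∃ a, a = √(‖m₀‖ / ‖h₀‖) := ⟨_, rfl⟩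
  obtain ⟨b, hb⟩ : ∃ b, b = √(‖h₀‖ / ‖m₀‖) := ⟨_, rfl⟩
  have ha0 : 0 < a := ha ▸ by positivity
  have hb0 : 0 < b := hb ▸ by positivity
  have hab : a * b = 1 := by
    rw [ha, hb, ← Real.sqrt_mul (by positivity), div_mul_div_comm, mul_comm ‖m₀‖,
      div_self (by positivity), Real.sqrt_one]
  have hbal : ‖a • h₀‖ = ‖b • m₀‖ := by
    have ha2 : a * a * ‖h₀‖ = ‖m₀‖ := by
      rw [ha, Real.mul_self_sqrt (by positivity), div_mul_cancel₀ _ hnh.ne']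
    rw [norm_smul, norm_smul, Real.norm_of_nonneg ha0.le, Real.norm_of_nonneg hb0.le, ← ha2]
    linear_combination (-a * ‖h₀‖) * hab
  have hsumh : ∀ x : Fin (K + 1) → ℝ, ∑ i, x i * (a • h₀) i = a * ∑ i, x i * h₀ i := fun x ↦ by
    simp only [PiLp.smul_apply, smul_eq_mul, Finset.mul_sum]
    exact Finset.sum_congr rfl fun _ _ ↦ by ring
  have hsumm : ∀ x : Fin (N + 1) → ℝ, ∑ i, x i * (b • m₀) i = b * ∑ i, x i * m₀ i := fun x ↦ by
    simp only [PiLp.smul_apply, smul_eq_mul, Finset.mul_sum]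
    exact Finset.sum_congr rfl fun _ _ ↦ by ring
  have hprod : ∀ x z : ℝ, a * x * (b * z) = x * z := fun x z ↦ by
    linear_combination (x * z) * hab
  have hsign : ∀ x : ℝ, Real.sign (a * x) = Real.sign x := fun x ↦ by
    rcases lt_trichotomy x 0 with hx | rfl | hx
    · rw [Real.sign_of_neg hx, Real.sign_of_neg (mul_neg_of_pos_of_neg ha0 hx)]
    · simp
    · rw [Real.sign_of_pos hx, Real.sign_of_pos (mul_pos ha0 hx)]
  have hmain := measure_compl_bhUniqueMin_le (L := L) (d := K + N) (smul_ne_zero ha0.ne' hh)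
    (smul_ne_zero hb0.ne' hm) hbal (by ring) (by omega) (by omega)
  simp only [hsumh, hsumm, hprod, hsign] at hmain
  rw [← ha, ← hb]
  refine ofReal_one_sub_le_measure_of_compl_le (Real.exp_nonneg _)
    (hmain.trans (ENNReal.ofReal_le_ofReal (Real.exp_le_exp.2 ?_)))
  have hdL' : 2 * ((K : ℝ) + N) + 1 < L := by exact_mod_cast hdL
  have hKN : (0 : ℝ) ≤ K + N := by positivity
  push_cast
  rw [neg_div, neg_div, neg_le_neg_iff, div_le_div_iff₀ (by linarith) (by linarith)]
  nlinarith [mul_nonneg hKN (sub_nonneg.2 hdL'.le), mul_nonneg hKN hL0.le,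
    mul_pos hL0 (sub_pos.2 hdL')]
end

section
/- Fix (h♮, m♮) ∈ ℝ^K × ℝ^N with h♮ ≠ 0 and m♮ ≠ 0. Let B ∈ ℝ^{L×K} and C ∈ ℝ^{L×N} have independent standard Gaussian N(0,1) entries. Let ξ ∈ ℝ^L with ε = ‖ξ‖_∞ ∈ [0,1], let y = (Bh♮) ∘ (Cm♮) ∘ (1 + ξ) (entrywise) and s = sign(Bh♮). There exist absolute constants C₀ > 0 and c > 0 such that if L ≥ C₀(K+N), then with probability at least 1 − e^{−cL} the unique minimizer (h*, m*) of the BranchHull program (BH) satisfies (‖h* − h♮·√(‖m♮‖₂/‖h♮‖₂)‖₂² + ‖m* − m♮·√(‖h♮‖₂/‖m♮‖₂)‖₂²)^{1/2} ≤ 4√ε · √(‖h♮‖₂‖m♮‖₂). -/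
open MeasureTheory ProbabilityTheory

open scoped RealInnerProductSpace

lemma sum_mul_eq_inner {n : ℕ} (b : Fin n → ℝ) (h : EuclideanSpace ℝ (Fin n)) :
    ∑ i, b i * h i = ⟪h, WithLp.toLp 2 b⟫ := by
  simp [PiLp.inner_apply]

/-- The standard Gaussian vector is invariant under the reflection fixing the line through `h`. -/
lemma exists_measurePreserving_reflection {n : ℕ} (h : EuclideanSpace ℝ (Fin n)) :
    ∃ R : (Fin n → ℝ) → (Fin n → ℝ),
      MeasurePreserving R (Measure.pi fun _ => gaussianReal 0 1)
        (Measure.pi fun _ => gaussianReal 0 1) ∧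
      (∀ b, ∑ i, R b i * h i = ∑ i, b i * h i) ∧
      ∀ (b) (p : EuclideanSpace ℝ (Fin n)), ⟪h, p⟫ = 0 →
        ∑ i, R b i * p i = -∑ i, b i * p i := by
  let ρ := Submodule.reflection (ℝ ∙ h)
  have hto : MeasurePreserving (WithLp.toLp 2 : (Fin n → ℝ) → EuclideanSpace ℝ (Fin n))
      (Measure.pi fun _ => gaussianReal 0 1) (stdGaussian (EuclideanSpace ℝ (Fin n))) :=
    ⟨by fun_prop, map_pi_eq_stdGaussian⟩
  have hof : MeasurePreserving (WithLp.ofLp : EuclideanSpace ℝ (Fin n) → (Fin n → ℝ))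
      (stdGaussian (EuclideanSpace ℝ (Fin n))) (Measure.pi fun _ => gaussianReal 0 1) := by
    refine ⟨by fun_prop, ?_⟩
    rw [← map_pi_eq_stdGaussian, Measure.map_map (by fun_prop) (by fun_prop)]
    exact Measure.map_id
  have hρ : MeasurePreserving ρ (stdGaussian (EuclideanSpace ℝ (Fin n)))
      (stdGaussian (EuclideanSpace ℝ (Fin n))) :=
    ⟨ρ.continuous.measurable, stdGaussian_map ρ⟩
  refine ⟨fun b => (ρ (WithLp.toLp 2 b)).ofLp, hof.comp (hρ.comp hto), fun b => ?_,
    fun b p hp => ?_⟩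
  · have hh : ρ h = h :=
      Submodule.reflection_mem_subspace_eq_self (Submodule.mem_span_singleton_self h)
    simp only [sum_mul_eq_inner, WithLp.toLp_ofLp]
    conv_lhs => rw [← hh]
    exact ρ.inner_map_map _ _
  · have hh : ρ p = -p :=
      Submodule.reflection_mem_subspace_orthogonalComplement_eq_neg
        (Submodule.mem_orthogonal_singleton_iff_inner_right.2 hp)
    simp only [sum_mul_eq_inner, WithLp.toLp_ofLp]
    rw [← ρ.inner_map_map, Submodule.reflection_reflection, hh, inner_neg_left]

lemma measure_pi_gaussianReal_hyperplane {n : ℕ} {h : EuclideanSpace ℝ (Fin n)} (hh : h ≠ 0) :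
    (Measure.pi fun _ : Fin n => gaussianReal 0 1) {b | ∑ i, b i * h i = 0} = 0 := by
  have hmeas : MeasurableSet {x : EuclideanSpace ℝ (Fin n) | ⟪h, x⟫ = 0} :=
    (isClosed_eq (by fun_prop) continuous_const).measurableSet
  have key : stdGaussian (EuclideanSpace ℝ (Fin n)) {x | ⟪h, x⟫ = 0} = 0 := by
    have hmap := IsGaussian.map_eq_gaussianReal
      (μ := stdGaussian (EuclideanSpace ℝ (Fin n))) (innerSL ℝ h)
    rw [variance_dual_stdGaussian] at hmap
    have hv : ((‖innerSL ℝ h‖ ^ 2).toNNReal) ≠ 0 := by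
      rw [innerSL_apply_norm]
      simpa using hh
    have := nullSingletonClass_gaussianReal (μ := (stdGaussian (EuclideanSpace ℝ (Fin n)))[innerSL ℝ h]) hv
    rw [← hmap] at this
    have h0 := measure_singleton (μ := Measure.map (innerSL ℝ h)
      (stdGaussian (EuclideanSpace ℝ (Fin n)))) (0 : ℝ)
    rwa [Measure.map_apply (by fun_prop) (measurableSet_singleton 0)] at h0
  rw [← map_pi_eq_stdGaussian, Measure.map_apply (by fun_prop) hmeas] at key
  simp only [sum_mul_eq_inner]
  exact key

lemma ae_gaussM_ne_zero {n : ℕ} (L : ℕ) {h : EuclideanSpace ℝ (Fin n)} (hh : h ≠ 0) :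
    ∀ᵐ B ∂gaussM L n, ∀ ℓ, ∑ i, B ℓ i * h i ≠ 0 := by
  refine ae_all_iff.2 fun ℓ => ?_
  have := (measurePreserving_eval (fun _ : Fin L => Measure.pi fun _ : Fin n => gaussianReal 0 1)
    ℓ).quasiMeasurePreserving.ae (p := fun b => ∑ i, b i * h i ≠ 0)
  refine this ?_
  simpa [ae_iff] using measure_pi_gaussianReal_hyperplane hh

/-- If all `2 ^ L` sign flips preserve `μ`, the measure of an event is controlled by the number of
flips that can bring a point into it. -/
lemma two_pow_mul_measure_le {Ω : Type*} [MeasurableSpace Ω] {μ : Measure Ω}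
    [IsProbabilityMeasure μ] {L : ℕ} {T : Finset (Fin L) → Ω → Ω}
    (hT : ∀ S, MeasurePreserving (T S) μ μ) {A : Set Ω} (hA : MeasurableSet A) {c : ENNReal}
    (𝒜 : Ω → Finset (Finset (Fin L))) (hc : ∀ ω, ((𝒜 ω).card : ENNReal) ≤ c)
    (h𝒜 : ∀ ω S, T S ω ∈ A → S ∈ 𝒜 ω) : 2 ^ L * μ A ≤ c := by
  classical
  calc 2 ^ L * μ A = ∑ S : Finset (Fin L), μ (T S ⁻¹' A) := by
        simp [(hT _).measure_preimage hA.nullMeasurableSet]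
    _ = ∫⁻ ω, ∑ S : Finset (Fin L), (T S ⁻¹' A).indicator 1 ω ∂μ := by
        rw [lintegral_finsetSum _ fun S _ =>
          measurable_one.indicator ((hT S).measurable hA)]
        simp_rw [lintegral_indicator_one ((hT _).measurable hA)]
    _ ≤ ∫⁻ _, c ∂μ := by
        refine lintegral_mono fun ω => le_trans ?_ (hc ω)
        calc ∑ S : Finset (Fin L), (T S ⁻¹' A).indicator (1 : Ω → ENNReal) ω
            ≤ ∑ S : Finset (Fin L), if S ∈ 𝒜 ω then 1 else 0 := by
              refine Finset.sum_le_sum fun S _ => ?_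
              by_cases hS : T S ω ∈ A
              · rw [if_pos (h𝒜 ω S hS)]
                exact Set.indicator_le_self _ _ _
              · simp [hS]
          _ = ((𝒜 ω).card : ENNReal) := by simp
    _ = c := by simp

/-- Sign patterns of linear functionals on `V` shatter no set of more than `dim V` indices. -/
lemma card_le_finrank_of_shatters {V : Type*} [AddCommGroup V] [Module ℝ V]
    [FiniteDimensional ℝ V] {ι : Type*} [DecidableEq ι] (f : ι → Module.Dual ℝ V)
    {𝒜 : Finset (Finset ι)} (h𝒜 : ∀ S ∈ 𝒜, ∃ w, ∀ i, if i ∈ S then 0 < f i w else f i w ≤ 0)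
    {s : Finset ι} (hs : 𝒜.Shatters s) : s.card ≤ Module.finrank ℝ V := by
  by_contra! hlt
  have hdep : ¬ LinearIndependent ℝ (fun i : s => f i) := fun hli => by
    have := hli.fintype_card_le_finrank
    rw [Subspace.dual_finrank_eq, Fintype.card_coe] at this
    omega
  have main : ∀ g : s → ℝ, ∑ i, g i • f i = 0 → ∀ i, g i ≤ 0 := by
    intro g hg i
    by_contra! hi
    obtain ⟨u, hu, hut⟩ := hs (t := (Finset.univ.filter fun i : s => 0 < g i).map
      (Function.Embedding.subtype _)) (by intro x; simp +contextual)
    obtain ⟨w, hw⟩ := h𝒜 u hu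
    have hmem : ∀ j : s, (j : ι) ∈ u ↔ 0 < g j := by
      intro j
      have := Finset.ext_iff.1 hut j
      simpa using this
    have hpos : 0 < ∑ i, g i * f i w := by
      refine Finset.sum_pos' (fun j _ => ?_) ⟨i, Finset.mem_univ _, ?_⟩
      · have := hw j
        split_ifs at this with hj
        · exact mul_nonneg ((hmem j).1 hj).le this.le
        · exact mul_nonneg_of_nonpos_of_nonpos (not_lt.1 fun h => hj ((hmem j).2 h)) this
      · have := hw i
        rw [if_pos ((hmem i).2 hi)] at this
        exact mul_pos hi this
    have h0 := congrArg (fun φ : Module.Dual ℝ V => φ w) hg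
    simp only [LinearMap.sum_apply, LinearMap.smul_apply, LinearMap.zero_apply, smul_eq_mul] at h0
    linarith
  refine hdep (Fintype.linearIndependent_iff.2 fun g hg i => le_antisymm (main g hg i) ?_)
  have := main (-g) (by
    rw [← neg_zero, ← hg, ← Finset.sum_neg_distrib]
    exact Finset.sum_congr rfl fun j _ => neg_smul (g j) (f j)) i
  simpa using this

lemma card_mul_four_pow_le {L d : ℕ} {𝒜 : Finset (Finset (Fin L))}
    (h𝒜 : ∀ s, 𝒜.Shatters s → s.card ≤ d) : 𝒜.card * 4 ^ L ≤ 4 ^ d * 5 ^ L := by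
  have h5 : ∑ s : Finset (Fin L), 4 ^ (L - s.card) = 5 ^ L := by
    simpa using Fin.sum_pow_mul_eq_add_pow (n := L) (1 : ℕ) 4
  calc 𝒜.card * 4 ^ L ≤ 𝒜.shatterer.card * 4 ^ L := by
        exact Nat.mul_le_mul_right _ (Finset.card_le_card_shatterer 𝒜)
    _ = ∑ s ∈ 𝒜.shatterer, 4 ^ L := by simp
    _ ≤ ∑ s ∈ 𝒜.shatterer, 4 ^ d * 4 ^ (L - s.card) := by
        refine Finset.sum_le_sum fun s hs => ?_
        rw [← pow_add]
        have := h𝒜 s (Finset.mem_shatterer.1 hs)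
        exact Nat.pow_le_pow_right (by norm_num) (by omega)
    _ ≤ ∑ s : Finset (Fin L), 4 ^ d * 4 ^ (L - s.card) :=
        Finset.sum_le_sum_of_subset (Finset.subset_univ _)
    _ = 4 ^ d * 5 ^ L := by rw [← Finset.mul_sum, h5]

lemma le_mul_of_convexComb {t X₁ Z₁ X₂ Z₂ a b : ℝ} (ht : 0 < t) (hX₁ : 0 ≤ X₁) (hX₂ : 0 ≤ X₂)
    (h₁ : t ≤ X₁ * Z₁) (h₂ : t ≤ X₂ * Z₂) (ha : 0 ≤ a) (hb : 0 ≤ b) (hab : a + b = 1) :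
    t ≤ (a * X₁ + b * X₂) * (a * Z₁ + b * Z₂) := by
  have hZ₁ : 0 < Z₁ := pos_of_mul_pos_right (ht.trans_le h₁) hX₁
  have hZ₂ : 0 < Z₂ := pos_of_mul_pos_right (ht.trans_le h₂) hX₂
  have hcross : 2 * t ≤ X₁ * Z₂ + X₂ * Z₁ := by
    have hprod : t * t ≤ (X₁ * Z₁) * (X₂ * Z₂) := mul_le_mul h₁ h₂ ht.le (ht.le.trans h₁)
    refine abs_le_of_sq_le_sq' ?_ (by positivity) |>.2
    nlinarith [sq_nonneg (X₁ * Z₂ - X₂ * Z₁)]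
  have e : t = a ^ 2 * t + b ^ 2 * t + a * b * (2 * t) := by
    linear_combination (-(a + b + 1)) * t * hab
  calc t = a ^ 2 * t + b ^ 2 * t + a * b * (2 * t) := e
    _ ≤ a ^ 2 * (X₁ * Z₁) + b ^ 2 * (X₂ * Z₂) + a * b * (X₁ * Z₂ + X₂ * Z₁) := by gcongr
    _ = _ := by ring

lemma BHFeas.convexComb {L K N : ℕ} {B : Fin L → Fin K → ℝ} {C : Fin L → Fin N → ℝ}
    {y s : Fin L → ℝ} (hs : ∀ ℓ, s ℓ = 1 ∨ s ℓ = -1) {h₁ h₂ : EuclideanSpace ℝ (Fin K)}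
    {m₁ m₂ : EuclideanSpace ℝ (Fin N)} (H₁ : BHFeas B C y s h₁ m₁) (H₂ : BHFeas B C y s h₂ m₂)
    {a b : ℝ} (ha : 0 ≤ a) (hb : 0 ≤ b) (hab : a + b = 1) :
    BHFeas B C y s (a • h₁ + b • h₂) (a • m₁ + b • m₂) := by
  intro ℓ
  obtain ⟨h1, h1s⟩ := H₁ ℓ
  obtain ⟨h2, h2s⟩ := H₂ ℓ
  simp only [sum_mul_eq_inner, inner_add_left, real_inner_smul_left] at *
  refine ⟨?_, ?_⟩
  · rcases eq_or_ne (y ℓ) 0 with hy | hy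
    · simp [hy]
    have hss : s ℓ * s ℓ = 1 := by rcases hs ℓ with h | h <;> simp [h]
    have key := le_mul_of_convexComb (abs_pos.2 hy) h1s h2s
      (Z₁ := Real.sign (y ℓ) * s ℓ * ⟪m₁, WithLp.toLp 2 (C ℓ)⟫)
      (Z₂ := Real.sign (y ℓ) * s ℓ * ⟪m₂, WithLp.toLp 2 (C ℓ)⟫)
      (h1.le.trans (le_of_eq ?_)) (h2.le.trans (le_of_eq ?_)) ha hb hab
    · refine key.trans (le_of_eq ?_)
      linear_combination Real.sign (y ℓ) *
        ((a * ⟪h₁, WithLp.toLp 2 (B ℓ)⟫ + b * ⟪h₂, WithLp.toLp 2 (B ℓ)⟫) *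
        (a * ⟪m₁, WithLp.toLp 2 (C ℓ)⟫ + b * ⟪m₂, WithLp.toLp 2 (C ℓ)⟫)) * hss
    · linear_combination (-Real.sign (y ℓ) *
        (⟪h₁, WithLp.toLp 2 (B ℓ)⟫ * ⟪m₁, WithLp.toLp 2 (C ℓ)⟫)) * hss
    · linear_combination (-Real.sign (y ℓ) *
        (⟪h₂, WithLp.toLp 2 (B ℓ)⟫ * ⟪m₂, WithLp.toLp 2 (C ℓ)⟫)) * hss
  · have := add_nonneg (mul_nonneg ha h1s) (mul_nonneg hb h2s)
    linarith

lemma isClosed_setOf_BHFeas {L K N : ℕ} (B : Fin L → Fin K → ℝ) (C : Fin L → Fin N → ℝ)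
    (y s : Fin L → ℝ) :
    IsClosed {x : WithLp 2 (EuclideanSpace ℝ (Fin K) × EuclideanSpace ℝ (Fin N)) |
      BHFeas B C y s x.fst x.snd} := by
  simp only [BHFeas, Set.ofPred_forall, Set.ofPred_and, sum_mul_eq_inner]
  refine isClosed_iInter fun ℓ => IsClosed.inter ?_ ?_
  · exact isClosed_le continuous_const (by fun_prop)
  · exact isClosed_le continuous_const (by fun_prop)

/-- A feasible BranchHull program has a unique minimizer, the projection of the origin. -/
lemma exists_BHUniqueMin {L K N : ℕ} {B : Fin L → Fin K → ℝ} {C : Fin L → Fin N → ℝ}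
    {y s : Fin L → ℝ} (hs : ∀ ℓ, s ℓ = 1 ∨ s ℓ = -1) {h₁ : EuclideanSpace ℝ (Fin K)}
    {m₁ : EuclideanSpace ℝ (Fin N)} (H₁ : BHFeas B C y s h₁ m₁) :
    ∃ h m, BHUniqueMin B C y s h m := by
  set A := {x : WithLp 2 (EuclideanSpace ℝ (Fin K) × EuclideanSpace ℝ (Fin N)) |
      BHFeas B C y s x.fst x.snd} with hA
  have hconv : Convex ℝ A := by
    intro x hx z hz a b ha hb hab
    exact BHFeas.convexComb hs hx hz ha hb hab
  obtain ⟨v, hv, hmin⟩ := exists_norm_eq_iInf_of_complete_convex (K := A)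
    ⟨WithLp.toLp 2 (h₁, m₁), H₁⟩ (isClosed_setOf_BHFeas B C y s).isComplete hconv 0
  rw [norm_eq_iInf_iff_real_inner_le_zero hconv hv] at hmin
  refine ⟨v.fst, v.snd, hv, fun h m H hne => ?_⟩
  have hw := hmin (WithLp.toLp 2 (h, m)) H
  set w : WithLp 2 (EuclideanSpace ℝ (Fin K) × EuclideanSpace ℝ (Fin N)) :=
    WithLp.toLp 2 (h, m) with hwdef
  have hwv : w - v ≠ 0 := by
    intro h0
    apply hne
    rw [← sub_eq_zero.1 h0]
    rfl
  have e1 := WithLp.prod_norm_sq_eq_of_L2 v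
  have e2 := WithLp.prod_norm_sq_eq_of_L2 w
  rw [zero_sub, inner_neg_left] at hw
  have e3 : ‖w‖ ^ 2 = ‖v‖ ^ 2 + 2 * ⟪v, w - v⟫ + ‖w - v‖ ^ 2 := by
    rw [← norm_add_sq_real, add_sub_cancel]
  have : 0 < ‖w - v‖ ^ 2 := by positivity
  change ‖v.fst‖ ^ 2 + ‖v.snd‖ ^ 2 < ‖w.fst‖ ^ 2 + ‖w.snd‖ ^ 2
  linarith

lemma sign_mul_ge_abs_iff {u v e x z : ℝ} (huv : u * v ≠ 0) (he : 0 < e) :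
    Real.sign (u * v * e) * (x * z) ≥ |u * v * e| ↔ (u * v) ^ 2 * e ≤ u * v * (x * z) := by
  rcases lt_or_gt_of_ne huv with h | h
  · rw [Real.sign_of_neg (mul_neg_of_neg_of_pos h he), abs_of_neg (mul_neg_of_neg_of_pos h he)]
    constructor <;> intro H <;> nlinarith
  · rw [Real.sign_of_pos (mul_pos h he), abs_of_pos (mul_pos h he)]
    constructor <;> intro H <;> nlinarith

lemma sign_mul_nonneg {u x : ℝ} (h : Real.sign u * x ≥ 0) : 0 ≤ u * x := by
  rcases lt_trichotomy u 0 with hu | hu | hu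
  · rw [Real.sign_of_neg hu] at h; nlinarith
  · simp [hu]
  · rw [Real.sign_of_pos hu] at h; nlinarith

lemma sign_mul_of_pos {a : ℝ} (ha : 0 < a) (u : ℝ) : Real.sign (a * u) = Real.sign u := by
  rcases lt_trichotomy u 0 with hu | rfl | hu
  · rw [Real.sign_of_neg hu, Real.sign_of_neg (mul_neg_of_pos_of_neg ha hu)]
  · rw [mul_zero]
  · rw [Real.sign_of_pos hu, Real.sign_of_pos (mul_pos ha hu)]

lemma BHFeas_scaled {L K N : ℕ} (B : Fin L → Fin K → ℝ) (C : Fin L → Fin N → ℝ)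
    (ξ : Fin L → ℝ) {t : ℝ} (ht : 0 ≤ t) (hξ : ∀ ℓ, |1 + ξ ℓ| ≤ t ^ 2)
    (h : EuclideanSpace ℝ (Fin K)) (m : EuclideanSpace ℝ (Fin N)) (hpos : ∀ ℓ, 0 ≤ 1 + ξ ℓ) :
    BHFeas B C (fun ℓ => (∑ i, B ℓ i * h i) * (∑ j, C ℓ j * m j) * (1 + ξ ℓ))
      (fun ℓ => Real.sign (∑ i, B ℓ i * h i)) (t • h) (t • m) := by
  have sign_mul_self (u : ℝ) : Real.sign u * u = |u| := by
    rcases lt_trichotomy u 0 with hu | hu | hu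
    · rw [Real.sign_of_neg hu, abs_of_neg hu]; ring
    · simp [hu]
    · rw [Real.sign_of_pos hu, abs_of_pos hu]; ring
  intro ℓ
  simp only [sum_mul_eq_inner, real_inner_smul_left]
  set u := ⟪h, WithLp.toLp 2 (B ℓ)⟫
  set v := ⟪m, WithLp.toLp 2 (C ℓ)⟫
  refine ⟨?_, ?_⟩
  · rcases (hpos ℓ).eq_or_lt with he | he
    · simp [← he]
    rcases eq_or_ne (u * v) 0 with huv | huv
    · simp [huv]
    rw [sign_mul_ge_abs_iff huv he]
    have := (le_abs_self _).trans (hξ ℓ)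
    nlinarith [sq_nonneg (u * v)]
  · have := mul_nonneg ht (abs_nonneg u)
    rw [← sign_mul_self] at this
    linarith

/-- Deviations orthogonal to the signal that strictly improve every linearised constraint. -/
def AscentEvent {L K N : ℕ} (h : EuclideanSpace ℝ (Fin K)) (m : EuclideanSpace ℝ (Fin N)) :
    Set ((Fin L → Fin K → ℝ) × (Fin L → Fin N → ℝ)) :=
  {x | ∃ w : EuclideanSpace ℝ (Fin K) × EuclideanSpace ℝ (Fin N), ⟪h, w.1⟫ = 0 ∧ ⟪m, w.2⟫ = 0 ∧
    ∀ ℓ, 0 < (∑ i, x.1 ℓ i * h i) * (∑ j, x.2 ℓ j * m j) *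
      ((∑ i, x.1 ℓ i * w.1 i) * (∑ j, x.2 ℓ j * m j) +
        (∑ i, x.1 ℓ i * h i) * (∑ j, x.2 ℓ j * w.2 j))}

lemma two_sub_le_of_mul_ge {A D ε : ℝ} (hA : 0 ≤ A) (hε : ε < 1) (hε₀ : 0 ≤ ε)
    (h : 1 - ε ≤ A * D) : 2 - 2 * ε ≤ A + D := by
  have hD : 0 < D := pos_of_mul_pos_right (lt_of_lt_of_le (by linarith) h) hA
  refine abs_le_of_sq_le_sq' ?_ (by positivity) |>.2
  nlinarith [sq_nonneg (A - D)]

/-- Away from the ascent event, low-cost feasible points are near the signal. -/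
lemma BHFeas.dist_sq_le {L K N : ℕ} {B : Fin L → Fin K → ℝ} {C : Fin L → Fin N → ℝ}
    {ξ : Fin L → ℝ} {h₀ h : EuclideanSpace ℝ (Fin K)} {m₀ m : EuclideanSpace ℝ (Fin N)} {r ε : ℝ}
    (hr : 0 < r) (hh : ‖h₀‖ = r) (hm : ‖m₀‖ = r) (hε₀ : 0 ≤ ε) (hε₁ : ε ≤ 1)
    (hξ : ∀ ℓ, |ξ ℓ| ≤ ε) (hB : ∀ ℓ, ∑ i, B ℓ i * h₀ i ≠ 0) (hC : ∀ ℓ, ∑ j, C ℓ j * m₀ j ≠ 0)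
    (hbad : (B, C) ∉ AscentEvent h₀ m₀)
    (H : BHFeas B C (fun ℓ => (∑ i, B ℓ i * h₀ i) * (∑ j, C ℓ j * m₀ j) * (1 + ξ ℓ))
      (fun ℓ => Real.sign (∑ i, B ℓ i * h₀ i)) h m)
    (hobj : ‖h‖ ^ 2 + ‖m‖ ^ 2 ≤ 2 * (1 + ε) * r ^ 2) :
    ‖h - h₀‖ ^ 2 + ‖m - m₀‖ ^ 2 ≤ 16 * ε * r ^ 2 := by
  have expand : ‖h - h₀‖ ^ 2 + ‖m - m₀‖ ^ 2 =
      ‖h‖ ^ 2 + ‖m‖ ^ 2 + 2 * r ^ 2 - 2 * (⟪h₀, h⟫ + ⟪m₀, m⟫) := by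
    rw [norm_sub_sq_real, norm_sub_sq_real, hh, hm, real_inner_comm h₀ h, real_inner_comm m₀ m]
    ring
  rcases hε₁.eq_or_lt with rfl | hε
  · have h1 := norm_add_sq_real h₀ h
    have h2 := norm_add_sq_real m₀ m
    rw [hh] at h1
    rw [hm] at h2
    nlinarith [sq_nonneg ‖h₀ + h‖, sq_nonneg ‖m₀ + m‖, sq_nonneg r]
  set a := ⟪h₀, h⟫ / r ^ 2 with ha
  set b := ⟪m₀, m⟫ / r ^ 2 with hb
  have hr2 : r ^ 2 ≠ 0 := by positivity
  have ha' : ⟪h₀, h⟫ = a * r ^ 2 := by rw [ha]; field_simp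
  have hb' : ⟪m₀, m⟫ = b * r ^ 2 := by rw [hb]; field_simp
  have horth : ∃ ℓ, (∑ i, B ℓ i * h₀ i) * (∑ j, C ℓ j * m₀ j) *
      ((∑ i, B ℓ i * (h - a • h₀) i) * (∑ j, C ℓ j * m₀ j) +
        (∑ i, B ℓ i * h₀ i) * (∑ j, C ℓ j * (m - b • m₀) j)) ≤ 0 := by
    by_contra! hcon
    refine hbad ⟨(h - a • h₀, m - b • m₀), ?_, ?_, hcon⟩
    · simp only [inner_sub_right, real_inner_smul_right, real_inner_self_eq_norm_sq, hh]
      linarith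
    · simp only [inner_sub_right, real_inner_smul_right, real_inner_self_eq_norm_sq, hm]
      linarith
  obtain ⟨ℓ, hℓ⟩ := horth
  obtain ⟨hf, hs⟩ := H ℓ
  have hu := hB ℓ
  have hv := hC ℓ
  have hξℓ := abs_le.1 (hξ ℓ)
  simp only [sum_mul_eq_inner, inner_sub_left, real_inner_smul_left] at hf hs hℓ hu hv
  set u := ⟪h₀, WithLp.toLp 2 (B ℓ)⟫
  set v := ⟪m₀, WithLp.toLp 2 (C ℓ)⟫
  set x := ⟪h, WithLp.toLp 2 (B ℓ)⟫
  set z := ⟪m, WithLp.toLp 2 (C ℓ)⟫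
  rw [sign_mul_ge_abs_iff (mul_ne_zero hu hv) (by linarith)] at hf
  have hux := sign_mul_nonneg hs
  have hu2 : 0 < u ^ 2 := by positivity
  have huv2 : 0 < (u * v) ^ 2 := by positivity
  have hA : 0 ≤ x / u := by
    rw [show x / u = u * x / u ^ 2 by field_simp]
    positivity
  have hAD : 1 - ε ≤ x / u * (z / v) := by
    rw [show x / u * (z / v) = u * v * (x * z) / (u * v) ^ 2 by field_simp, le_div_iff₀ huv2]
    nlinarith
  have hsum := two_sub_le_of_mul_ge hA hε hε₀ hAD
  have hab : x / u + z / v - (a + b) ≤ 0 := by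
    rw [show x / u + z / v - (a + b) =
      u * v * ((x - a * u) * v + u * (z - b * v)) / (u * v) ^ 2 by field_simp; ring]
    exact div_nonpos_of_nonpos_of_nonneg hℓ huv2.le
  rw [expand, ha', hb']
  nlinarith [sq_nonneg r, mul_nonneg hε₀ (sq_nonneg r)]

lemma isOpen_ascentEvent {L K N : ℕ} (h : EuclideanSpace ℝ (Fin K))
    (m : EuclideanSpace ℝ (Fin N)) : IsOpen (AscentEvent (L := L) h m) := by
  simp only [AscentEvent, Set.ofPred_exists, Set.ofPred_and, Set.ofPred_forall]
  refine isOpen_iUnion fun w => isOpen_const.inter (isOpen_const.inter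
    (isOpen_iInter_of_finite fun ℓ => ?_))
  exact isOpen_lt continuous_const (by fun_prop)

/-- Reflecting the rows indexed by `S` preserves the Gaussian measure. -/
lemma measurePreserving_flip {L n : ℕ} {R : (Fin n → ℝ) → (Fin n → ℝ)}
    (hR : MeasurePreserving R (Measure.pi fun _ => gaussianReal 0 1)
      (Measure.pi fun _ => gaussianReal 0 1)) (S : Finset (Fin L)) :
    MeasurePreserving (fun (B : Fin L → Fin n → ℝ) ℓ => if ℓ ∈ S then R (B ℓ) else B ℓ)
      (gaussM L n) (gaussM L n) := by
  refine measurePreserving_pi _ _ (f := fun ℓ b => if ℓ ∈ S then R b else b) fun ℓ => ?_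
  by_cases hℓ : ℓ ∈ S
  · simpa [hℓ] using hR
  · simp only [hℓ, if_false]
    exact MeasurePreserving.id _

instance (L n : ℕ) : IsProbabilityMeasure (gaussM L n) := by
  unfold gaussM; infer_instance

open Classical in
lemma two_pow_mul_measure_ascentEvent_le {L K N : ℕ} (h : EuclideanSpace ℝ (Fin K))
    (m : EuclideanSpace ℝ (Fin N)) :
    2 ^ L * ((gaussM L K).prod (gaussM L N)) (AscentEvent h m) ≤
      ENNReal.ofReal (4 ^ (K + N) * (5 / 4) ^ L) := by
  obtain ⟨R, hR, hRh, hRp⟩ := exists_measurePreserving_reflection h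
  obtain ⟨Q, hQ, hQm, hQp⟩ := exists_measurePreserving_reflection m
  let G (x : (Fin L → Fin K → ℝ) × (Fin L → Fin N → ℝ)) (ℓ : Fin L)
      (w : EuclideanSpace ℝ (Fin K) × EuclideanSpace ℝ (Fin N)) : ℝ :=
    (∑ i, x.1 ℓ i * h i) * (∑ j, x.2 ℓ j * m j) *
      ((∑ i, x.1 ℓ i * w.1 i) * (∑ j, x.2 ℓ j * m j) +
        (∑ i, x.1 ℓ i * h i) * (∑ j, x.2 ℓ j * w.2 j))
  have hG (x ℓ) : IsLinearMap ℝ fun w => -G x ℓ w := by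
    constructor
    · intro w w'
      simp only [G, sum_mul_eq_inner, Prod.fst_add, Prod.snd_add, inner_add_left]
      ring
    · intro c w
      simp only [G, sum_mul_eq_inner, Prod.smul_fst, Prod.smul_snd, real_inner_smul_left,
        smul_eq_mul]
      ring
  refine two_pow_mul_measure_le
    (fun S => (measurePreserving_flip hR S).prod (measurePreserving_flip hQ S))
    (isOpen_ascentEvent h m).measurableSet
    (fun x => Finset.univ.filter fun S => ∃ w, ∀ ℓ, if ℓ ∈ S then 0 < -G x ℓ w else -G x ℓ w ≤ 0)
    (fun x => ?_) ?_
  · have hcard := card_mul_four_pow_le (L := L) (d := K + N)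
      (𝒜 := Finset.univ.filter fun S => ∃ w, ∀ ℓ, if ℓ ∈ S then 0 < -G x ℓ w else -G x ℓ w ≤ 0)
      fun s hs => (card_le_finrank_of_shatters (fun ℓ => (hG x ℓ).mk') (by simp) hs).trans
        (by simp)
    rw [← ENNReal.ofReal_natCast]
    refine ENNReal.ofReal_le_ofReal ?_
    rw [div_pow, ← mul_div_assoc, le_div_iff₀ (by positivity)]
    exact_mod_cast hcard
  · rintro x S ⟨w, hw1, hw2, hw⟩
    refine Finset.mem_filter.2 ⟨Finset.mem_univ _, w, fun ℓ => ?_⟩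
    have := hw ℓ
    by_cases hℓ : ℓ ∈ S
    · simp only [Prod.map_fst, Prod.map_snd, hℓ, if_true, hRh, hQm, hRp _ _ hw1,
        hQp _ _ hw2] at this ⊢
      simp only [G]
      linarith
    · simp only [Prod.map_fst, Prod.map_snd, hℓ, if_false] at this ⊢
      simp only [G]
      linarith

lemma measure_ascentEvent_le {L K N : ℕ} (hL : 10 * (K + N) ≤ (L : ℝ))
    (h : EuclideanSpace ℝ (Fin K)) (m : EuclideanSpace ℝ (Fin N)) :
    ((gaussM L K).prod (gaussM L N)) (AscentEvent h m) ≤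
      ENNReal.ofReal (Real.exp (-(1 / 10) * L)) := by
  have h4 : (4 : ℝ) ≤ Real.exp 2 := by
    have := Real.add_one_le_exp (1 : ℝ)
    rw [show (2 : ℝ) = 1 + 1 by norm_num, Real.exp_add]
    nlinarith
  have h58 : (5 / 8 : ℝ) ≤ Real.exp (-(3 / 8)) := by
    have := Real.add_one_le_exp (-(3 / 8) : ℝ)
    linarith
  have hnum : (4 : ℝ) ^ (K + N) * (5 / 4) ^ L ≤ 2 ^ L * Real.exp (-(1 / 10) * L) := by
    calc (4 : ℝ) ^ (K + N) * (5 / 4) ^ L = 2 ^ L * (4 ^ (K + N) * (5 / 8) ^ L) := by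
          rw [mul_left_comm, ← mul_pow]; norm_num
      _ ≤ 2 ^ L * (Real.exp 2 ^ (K + N) * Real.exp (-(3 / 8)) ^ L) := by gcongr
      _ ≤ 2 ^ L * Real.exp (-(1 / 10) * L) := by
          rw [← Real.exp_nat_mul, ← Real.exp_nat_mul, ← Real.exp_add]
          gcongr
          push_cast
          linarith [Nat.cast_nonneg (α := ℝ) L]
  have := (two_pow_mul_measure_ascentEvent_le (L := L) h m).trans (ENNReal.ofReal_le_ofReal hnum)
  rw [ENNReal.ofReal_mul (by positivity), ENNReal.ofReal_pow (by norm_num), ENNReal.ofReal_ofNat]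
    at this
  exact (ENNReal.mul_le_mul_iff_right (by simp) (by simp)).1 this

/-- Noisy BranchHull recovery: note that for `ξ : Fin L → ℝ`, the norm `‖ξ‖` is the
sup norm `‖ξ‖_∞`, playing the role of the noise level `ε ∈ [0,1]`. -/
theorem stmt1 :
    ∃ C₀ c : ℝ, 0 < C₀ ∧ 0 < c ∧
      ∀ (K N L : ℕ) (h₀ : EuclideanSpace ℝ (Fin K)) (m₀ : EuclideanSpace ℝ (Fin N))
        (ξ : Fin L → ℝ), h₀ ≠ 0 → m₀ ≠ 0 → ‖ξ‖ ≤ 1 → C₀ * (K + N) ≤ (L : ℝ) →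
        ENNReal.ofReal (1 - Real.exp (-c * L)) ≤
          (Measure.prod (gaussM L K) (gaussM L N))
            {p | ∃ (hs : EuclideanSpace ℝ (Fin K)) (ms : EuclideanSpace ℝ (Fin N)),
              BHUniqueMin p.1 p.2
                (fun ℓ => (∑ i, p.1 ℓ i * h₀ i) * (∑ j, p.2 ℓ j * m₀ j) * (1 + ξ ℓ))
                (fun ℓ => Real.sign (∑ i, p.1 ℓ i * h₀ i)) hs ms ∧
              Real.sqrt (‖hs - Real.sqrt (‖m₀‖ / ‖h₀‖) • h₀‖ ^ 2 +
                  ‖ms - Real.sqrt (‖h₀‖ / ‖m₀‖) • m₀‖ ^ 2) ≤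
                4 * Real.sqrt ‖ξ‖ * Real.sqrt (‖h₀‖ * ‖m₀‖)} := by
  refine ⟨10, 1 / 10, by norm_num, by norm_num, fun K N L h₀ m₀ ξ hh hm hξ hL => ?_⟩
  set μ := (gaussM L K).prod (gaussM L N)
  have hh' : 0 < ‖h₀‖ := norm_pos_iff.2 hh
  have hm' : 0 < ‖m₀‖ := norm_pos_iff.2 hm
  set a := Real.sqrt (‖m₀‖ / ‖h₀‖) with ha
  set b := Real.sqrt (‖h₀‖ / ‖m₀‖) with hb
  set r := Real.sqrt (‖h₀‖ * ‖m₀‖) with hr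
  have ha0 : 0 < a := Real.sqrt_pos.2 (by positivity)
  have hr0 : 0 < r := Real.sqrt_pos.2 (by positivity)
  have hab : a * b = 1 := by
    rw [ha, hb, ← Real.sqrt_mul (by positivity), Real.sqrt_eq_one]
    field_simp
  have hah : ‖a • h₀‖ = r := by
    rw [norm_smul, Real.norm_of_nonneg ha0.le]
    refine (Real.sqrt_eq_iff_mul_self_eq (by positivity) (by positivity)).2 ?_ |>.symm
    rw [mul_mul_mul_comm, ha, Real.mul_self_sqrt (by positivity)]
    field_simp
  have hbm : ‖b • m₀‖ = r := by
    rw [norm_smul, Real.norm_of_nonneg (Real.sqrt_nonneg _)]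
    refine (Real.sqrt_eq_iff_mul_self_eq (by positivity) (by positivity)).2 ?_ |>.symm
    rw [mul_mul_mul_comm, Real.mul_self_sqrt (by positivity)]
    field_simp
  have hξ' : ∀ ℓ, |ξ ℓ| ≤ ‖ξ‖ := fun ℓ => norm_le_pi_norm ξ ℓ
  set A := AscentEvent (L := L) (a • h₀) (b • m₀)
  set G := {p : (Fin L → Fin K → ℝ) × (Fin L → Fin N → ℝ) |
    ∃ (hs : EuclideanSpace ℝ (Fin K)) (ms : EuclideanSpace ℝ (Fin N)),
      BHUniqueMin p.1 p.2
        (fun ℓ => (∑ i, p.1 ℓ i * h₀ i) * (∑ j, p.2 ℓ j * m₀ j) * (1 + ξ ℓ))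
        (fun ℓ => Real.sign (∑ i, p.1 ℓ i * h₀ i)) hs ms ∧
      Real.sqrt (‖hs - a • h₀‖ ^ 2 + ‖ms - b • m₀‖ ^ 2) ≤ 4 * Real.sqrt ‖ξ‖ * r}
  have hdet : ∀ p : (Fin L → Fin K → ℝ) × (Fin L → Fin N → ℝ),
      (∀ ℓ, ∑ i, p.1 ℓ i * h₀ i ≠ 0) → (∀ ℓ, ∑ j, p.2 ℓ j * m₀ j ≠ 0) → p ∉ A → p ∈ G := by
    rintro ⟨B, C⟩ hB hC hA
    have hsB (ℓ) : ∑ i, B ℓ i * (a • h₀) i = a * ∑ i, B ℓ i * h₀ i := by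
      simp only [sum_mul_eq_inner, real_inner_smul_left]
    have hsC (ℓ) : ∑ j, C ℓ j * (b • m₀) j = b * ∑ j, C ℓ j * m₀ j := by
      simp only [sum_mul_eq_inner, real_inner_smul_left]
    have hb0 : b ≠ 0 := right_ne_zero_of_mul_eq_one hab
    have hy : (fun ℓ => (∑ i, B ℓ i * h₀ i) * (∑ j, C ℓ j * m₀ j) * (1 + ξ ℓ)) =
        fun ℓ => (∑ i, B ℓ i * (a • h₀) i) * (∑ j, C ℓ j * (b • m₀) j) * (1 + ξ ℓ) := by
      funext ℓ
      rw [hsB, hsC]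
      linear_combination (-((∑ i, B ℓ i * h₀ i) * (∑ j, C ℓ j * m₀ j) * (1 + ξ ℓ))) * hab
    have hs : (fun ℓ => Real.sign (∑ i, B ℓ i * h₀ i)) =
        fun ℓ => Real.sign (∑ i, B ℓ i * (a • h₀) i) := by
      funext ℓ
      rw [hsB, sign_mul_of_pos ha0]
    have hs1 : ∀ ℓ, Real.sign (∑ i, B ℓ i * (a • h₀) i) = 1 ∨
        Real.sign (∑ i, B ℓ i * (a • h₀) i) = -1 := fun ℓ =>
      (Real.sign_apply_eq_of_ne_zero _ (by rw [hsB]; exact mul_ne_zero ha0.ne' (hB ℓ))).symm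
    have hfeas := BHFeas_scaled B C ξ (Real.sqrt_nonneg (1 + ‖ξ‖))
      (fun ℓ => by
        rw [Real.sq_sqrt (by positivity)]
        exact (abs_add_le _ _).trans (by simpa using hξ' ℓ))
      (a • h₀) (b • m₀) (fun ℓ => by linarith [(abs_le.1 ((hξ' ℓ).trans hξ)).1])
    obtain ⟨h, m, hmin⟩ := exists_BHUniqueMin hs1 hfeas
    have hobj : ‖h‖ ^ 2 + ‖m‖ ^ 2 ≤ 2 * (1 + ‖ξ‖) * r ^ 2 := by
      have e : ‖Real.sqrt (1 + ‖ξ‖) • a • h₀‖ ^ 2 + ‖Real.sqrt (1 + ‖ξ‖) • b • m₀‖ ^ 2 =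
          2 * (1 + ‖ξ‖) * r ^ 2 := by
        rw [norm_smul _ (a • h₀), norm_smul _ (b • m₀), hah, hbm, mul_pow, Real.norm_eq_abs,
          sq_abs, Real.sq_sqrt (by positivity)]
        ring
      rw [← e]
      by_cases hne : (Real.sqrt (1 + ‖ξ‖) • a • h₀, Real.sqrt (1 + ‖ξ‖) • b • m₀) = (h, m)
      · rw [Prod.mk.injEq] at hne
        rw [hne.1, hne.2]
      · exact (hmin.2 _ _ hfeas hne).le
    refine ⟨h, m, ?_, ?_⟩
    · simp only [hy, hs]
      exact hmin
    · have hd := BHFeas.dist_sq_le hr0 hah hbm (norm_nonneg ξ) hξ hξ'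
        (fun ℓ => by rw [hsB]; exact mul_ne_zero ha0.ne' (hB ℓ))
        (fun ℓ => by rw [hsC]; exact mul_ne_zero hb0 (hC ℓ)) hA hmin.1 hobj
      refine Real.sqrt_le_iff.2 ⟨by positivity, hd.trans (le_of_eq ?_)⟩
      rw [mul_pow, mul_pow, Real.sq_sqrt (norm_nonneg ξ)]
      norm_num
  have hae : ∀ᵐ p ∂μ, p ∈ Aᶜ → p ∈ G := by
    filter_upwards [Measure.quasiMeasurePreserving_fst.ae (ae_gaussM_ne_zero L hh),
      Measure.quasiMeasurePreserving_snd.ae (ae_gaussM_ne_zero L hm)] with p hB hC hA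
    exact hdet p hB hC hA
  calc ENNReal.ofReal (1 - Real.exp (-(1 / 10) * L))
      = 1 - ENNReal.ofReal (Real.exp (-(1 / 10) * L)) := by
        rw [ENNReal.ofReal_sub _ (Real.exp_pos _).le, ENNReal.ofReal_one]
    _ ≤ 1 - μ A := tsub_le_tsub_left (measure_ascentEvent_le hL _ _) _
    _ = μ Aᶜ := (prob_compl_eq_one_sub (isOpen_ascentEvent _ _).measurableSet).symm
    _ ≤ μ G := measure_mono_ae hae
end

section
/- Let y ∈ ℝ with y ≠ 0 and s ∈ {−1,1}. Then {(w,x) ∈ ℝ² : sign(y)·w·x ≥ |y| and s·w ≥ 0} equals the convex hull of the hyperbola branch {(w,x) ∈ ℝ² : w·x = y and sign(w) = s}. -/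
/-- A branch of the region above a hyperbola is convex. -/
theorem convex_setOf_le_mul {c : ℝ} (hc : 0 < c) :
    Convex ℝ {p : ℝ × ℝ | c ≤ p.1 * p.2 ∧ 0 ≤ p.1} := by
  rintro ⟨u, v⟩ ⟨h, hu⟩ ⟨u', v'⟩ ⟨h', hu'⟩ a b ha hb hab
  dsimp only at h hu h' hu'
  have hv : 0 < v := pos_of_mul_pos_right (hc.trans_le h) hu
  have hv' : 0 < v' := pos_of_mul_pos_right (hc.trans_le h') hu'
  have hcross : 2 * c ≤ u * v' + u' * v := by
    have hprod : c * c ≤ (u * v) * (u' * v') := mul_le_mul h h' hc.le (hc.le.trans h)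
    refine le_of_sq_le_sq ?_ (by positivity)
    nlinarith [sq_nonneg (u * v' - u' * v)]
  refine ⟨?_, ?_⟩
  · simp only [Prod.smul_mk, Prod.mk_add_mk, smul_eq_mul]
    calc c = a ^ 2 * c + b ^ 2 * c + a * b * (2 * c) := by
          linear_combination (-c * (a + b + 1)) * hab
      _ ≤ a ^ 2 * (u * v) + b ^ 2 * (u' * v') + a * b * (u * v' + u' * v) := by gcongr
      _ = (a * u + b * u') * (a * v + b * v') := by ring
  · simp only [Prod.smul_mk, Prod.mk_add_mk, smul_eq_mul]
    positivity

/-- A point `(w, x)` with `y / (w * x) ∈ (0, 1]` is the midpoint of two points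
`(w * (1 ± r), x * (1 ∓ r))` of the hyperbola branch through the same quadrant. -/
theorem mem_convexHull_hyperbola_branch {y w x : ℝ} (hwx : w * x ≠ 0)
    (hpos : 0 < y / (w * x)) (hle : y / (w * x) ≤ 1) :
    (w, x) ∈ convexHull ℝ {p : ℝ × ℝ | p.1 * p.2 = y ∧ Real.sign p.1 = Real.sign w} := by
  set r := √(1 - y / (w * x))
  have hr0 : 0 ≤ r := Real.sqrt_nonneg _
  have hr2 : r ^ 2 = 1 - y / (w * x) := Real.sq_sqrt (by linarith)
  have hr1 : r < 1 := by nlinarith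
  have hy : w * x * (1 - r ^ 2) = y := by rw [hr2, sub_sub_cancel, mul_div_cancel₀ _ hwx]
  have hsign {k : ℝ} (hk : 0 < k) : Real.sign (w * k) = Real.sign w := by
    rcases lt_trichotomy w 0 with h | rfl | h
    · rw [Real.sign_of_neg h, Real.sign_of_neg (mul_neg_of_neg_of_pos h hk)]
    · simp
    · rw [Real.sign_of_pos h, Real.sign_of_pos (mul_pos h hk)]
  have hmem := convex_convexHull ℝ {p : ℝ × ℝ | p.1 * p.2 = y ∧ Real.sign p.1 = Real.sign w}
    (subset_convexHull ℝ _
      (show (w * (1 + r), x * (1 - r)) ∈ _ from ⟨by linear_combination hy, hsign (by linarith)⟩))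
    (subset_convexHull ℝ _
      (show (w * (1 - r), x * (1 + r)) ∈ _ from ⟨by linear_combination hy, hsign (by linarith)⟩))
    (show (0 : ℝ) ≤ 1 / 2 by norm_num) (show (0 : ℝ) ≤ 1 / 2 by norm_num) (by norm_num)
  convert hmem using 1
  ext <;> simp <;> ring

/-- The relaxed constraint set is exactly the convex hull of the corresponding branch
of the hyperbola `{(w,x) : w·x = y, sign(w) = s}`. -/
theorem stmt4 (y s : ℝ) (hy : y ≠ 0) (hs : s = 1 ∨ s = -1) :
    {p : ℝ × ℝ | Real.sign y * (p.1 * p.2) ≥ |y| ∧ s * p.1 ≥ 0} =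
      convexHull ℝ {p : ℝ × ℝ | p.1 * p.2 = y ∧ Real.sign p.1 = s} := by
  have hs2 : s * s = 1 := by rcases hs with rfl | rfl <;> norm_num
  have hsy : Real.sign y * y = |y| := by
    rcases hy.lt_or_gt with h | h
    · rw [Real.sign_of_neg h, abs_of_neg h]; ring
    · rw [Real.sign_of_pos h, abs_of_pos h]; ring
  have hy' : 0 < |y| := abs_pos.mpr hy
  apply Set.Subset.antisymm
  · rintro ⟨w, x⟩ ⟨h, hw⟩
    dsimp only at h hw
    have hwx : w * x ≠ 0 := by
      intro h0
      rw [h0, mul_zero] at h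
      linarith
    have hws : Real.sign w = s := by
      have hw0 : w ≠ 0 := left_ne_zero_of_mul hwx
      rcases hs with rfl | rfl
      · exact Real.sign_of_pos (lt_of_le_of_ne (by linarith) hw0.symm)
      · exact Real.sign_of_neg (lt_of_le_of_ne (by linarith) hw0)
    have hquot : y / (w * x) = |y| / (Real.sign y * (w * x)) := by
      rw [← hsy, mul_div_mul_left _ _ (mt Real.sign_eq_zero_iff.mp hy)]
    rw [← hws]
    apply mem_convexHull_hyperbola_branch hwx
    · rw [hquot]
      exact div_pos hy' (hy'.trans_le h)
    · rw [hquot]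
      exact div_le_one_of_le₀ h (hy'.le.trans h)
  · apply convexHull_min
    · rintro ⟨w, x⟩ ⟨h, hw⟩
      dsimp only at h hw
      refine ⟨by rw [h, hsy], ?_⟩
      rw [← hw]
      exact Real.sign_mul_nonneg w
    · have hconv := (convex_setOf_le_mul hy').linear_preimage
        ((s • LinearMap.fst ℝ ℝ ℝ).prod ((s * Real.sign y) • LinearMap.snd ℝ ℝ ℝ))
      convert hconv using 1
      ext ⟨w, x⟩
      have hmul : s * w * (s * Real.sign y * x) = Real.sign y * (w * x) := by
        linear_combination (Real.sign y * (w * x)) * hs2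
      simp [hmul]
end

section
/- Let w♮, x♮ ∈ ℝ and set y = w♮·x♮. Then {(w,x) ∈ ℝ² : y·w·x ≥ y² and sign(w) = sign(w♮)} ⊆ {(w,x) ∈ ℝ² : y·x♮·(w − w♮) + y·w♮·(x − x♮) ≥ 0}; that is, the branch of the region y·w·x ≥ y² containing (w♮,x♮) is contained in the halfspace determined by the tangent hyperplane at (w♮,x♮). -/
/-- The branch of the region `y·w·x ≥ y²` containing `(w♮, x♮)` is contained in the
halfspace determined by the tangent hyperplane at `(w♮, x♮)`. -/
theorem stmt6 (w₀ x₀ y : ℝ) (hy : y = w₀ * x₀) :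
    {p : ℝ × ℝ | y * (p.1 * p.2) ≥ y ^ 2 ∧ Real.sign p.1 = Real.sign w₀} ⊆
      {p : ℝ × ℝ | y * x₀ * (p.1 - w₀) + y * w₀ * (p.2 - x₀) ≥ 0} := by
  rintro ⟨w, x⟩ ⟨h, hs⟩
  simp only [Set.mem_ofPred_eq, ge_iff_le] at h hs ⊢
  rcases eq_or_ne y 0 with h0 | h0
  · simp [h0]
  have hw₀ : w₀ ≠ 0 := by rintro rfl; simp [hy] at h0
  have hx₀ : x₀ ≠ 0 := by rintro rfl; simp [hy] at h0
  have hw : 0 < w * w₀ := by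
    rcases lt_or_gt_of_ne hw₀ with h1 | h1 <;> rcases lt_trichotomy w 0 with h2 | h2 | h2
    · exact mul_pos_of_neg_of_neg h2 h1
    · norm_num [h2, Real.sign_of_neg h1] at hs
    · norm_num [Real.sign_of_pos h2, Real.sign_of_neg h1] at hs
    · norm_num [Real.sign_of_neg h2, Real.sign_of_pos h1] at hs
    · norm_num [h2, Real.sign_of_pos h1] at hs
    · exact mul_pos h2 h1
  have hy2 : 0 < y ^ 2 := by positivity
  have ha : 0 < y * x₀ * w := by
    have : y * x₀ * w = x₀ ^ 2 * (w * w₀) := by rw [hy]; ring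
    rw [this]; positivity
  have hab : (y ^ 2) ^ 2 ≤ (y * x₀ * w) * (y * w₀ * x) := by
    have : (y * x₀ * w) * (y * w₀ * x) = y ^ 2 * (y * (w * x)) := by
      linear_combination (-(y ^ 2 * (w * x))) * hy
    rw [this, sq (y ^ 2)]
    exact mul_le_mul_of_nonneg_left h hy2.le
  have hb : 0 < y * w₀ * x := pos_of_mul_pos_right (lt_of_lt_of_le (by positivity) hab) ha.le
  have hsum : 2 * y ^ 2 ≤ y * x₀ * w + y * w₀ * x := by
    refine abs_le_of_sq_le_sq' ?_ (by positivity) |>.2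
    nlinarith [sq_nonneg (y * x₀ * w - y * w₀ * x)]
  have : y * x₀ * (w - w₀) + y * w₀ * (x - x₀) = y * x₀ * w + y * w₀ * x - 2 * y ^ 2 := by
    linear_combination (2 * y) * hy
  linarith
end

section
/- Let B ∈ ℝ^{L×K} and C ∈ ℝ^{L×N} have independent standard Gaussian N(0,1) entries, with ℓ-th rows bℓᵀ = (bℓ1, b̃ℓᵀ) and cℓᵀ = (cℓ1, c̃ℓᵀ). If L − 1 ≥ 2(N + K − 2), then with probability at least 1 − exp(−[(L−1) − 2(N+K−2)]²/(2(L−1))), the following holds: for every (δh̃, δm̃) ∈ ℝ^{N−1} × ℝ^{K−1} there exists ℓ ∈ {1,…,L} such that ⟨c̃ℓ/cℓ1, δm̃⟩ + ⟨b̃ℓ/bℓ1, δh̃⟩ ≤ 0. -/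
open MeasureTheory ProbabilityTheory

open Finset in
/-- The family of sign patterns (encoded by their positive part) that the vectors `x i` take on
some open cell of the central hyperplane arrangement `(x i)ᗮ`. -/
noncomputable def signPatterns {ι κ : Type*} [Fintype ι] [DecidableEq ι] [Fintype κ]
    (x : ι → κ → ℝ) : Finset (Finset ι) :=
  open Classical in
  univ.filter fun s => ∃ δ : κ → ℝ, ∀ i, 0 < (if i ∈ s then 1 else -1) * (x i ⬝ᵥ δ)

lemma linearIndepOn_of_shatters_signPatterns {ι κ : Type*} [Fintype ι] [DecidableEq ι]
    [Fintype κ] {x : ι → κ → ℝ} {s : Finset ι} (hs : (signPatterns x).Shatters s) :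
    LinearIndepOn ℝ x (s : Set ι) := by
  rw [linearIndepOn_finset_iff]
  intro a ha
  by_contra! hne
  obtain ⟨i, his, hi⟩ := hne
  obtain ⟨u, hu, hsu⟩ := hs (Finset.filter_subset (fun j => 0 < a j) s)
  simp only [signPatterns, Finset.mem_filter, Finset.mem_univ, true_and] at hu
  obtain ⟨δ, hδ⟩ := hu
  have hmem : ∀ j ∈ s, (j ∈ u ↔ 0 < a j) := fun j hj => by
    have := congrArg (j ∈ ·) hsu
    simpa [hj] using this
  have hsum : ∑ j ∈ s, a j * (x j ⬝ᵥ δ) = 0 := by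
    have := congrArg (· ⬝ᵥ δ) ha
    simpa [sum_dotProduct] using this
  have hnonneg : ∀ j ∈ s, 0 ≤ a j * (x j ⬝ᵥ δ) := fun j hj => by
    have h := hδ j
    rcases lt_or_ge 0 (a j) with h0 | h0
    · rw [if_pos ((hmem j hj).2 h0), one_mul] at h
      positivity
    · rw [if_neg fun hju => h0.not_gt ((hmem j hj).1 hju)] at h
      nlinarith
  have hzero := (Finset.sum_eq_zero_iff_of_nonneg hnonneg).1 hsum i his
  rcases mul_eq_zero.1 hzero with h | h
  · exact hi h
  · simpa [h] using hδ i

/-- The number of sign patterns is bounded by the Sauer–Shelah lemma. -/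
lemma card_signPatterns_le {ι κ : Type*} [Fintype ι] [DecidableEq ι] [Fintype κ]
    (x : ι → κ → ℝ) :
    (signPatterns x).card ≤
      ∑ k ∈ Finset.Iic (Fintype.card κ), (Fintype.card ι).choose k := by
  refine (Finset.card_le_card_shatterer _).trans
    (Finset.card_shatterer_le_sum_vcDim.trans (Finset.sum_le_sum_of_subset ?_))
  refine Finset.Iic_subset_Iic.2 (Finset.sup_le fun s hs => ?_)
  have h := (linearIndepOn_of_shatters_signPatterns (Finset.mem_shatterer.1 hs)).linearIndependent
  simpa using h.fintype_card_le_finrank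

/-- Chernoff's bound on the lower tail of the binomial distribution with parameter `1/2`. -/
lemma sum_choose_le_two_pow_mul_exp {n d : ℕ} (hn : 0 < n) (hd : 2 * d ≤ n) :
    (∑ k ∈ Finset.Iic d, (n.choose k : ℝ)) ≤
      2 ^ n * Real.exp (-((n : ℝ) - 2 * d) ^ 2 / (2 * n)) := by
  have hn' : (0 : ℝ) < n := by exact_mod_cast hn
  have hd' : 2 * (d : ℝ) ≤ n := by exact_mod_cast hd
  set t : ℝ := (n - 2 * d) / n with ht
  have ht0 : 0 ≤ t := div_nonneg (by linarith) hn'.le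
  calc (∑ k ∈ Finset.Iic d, (n.choose k : ℝ))
      ≤ ∑ k ∈ Finset.Iic d,
          Real.exp (t * (2 * d - n)) * (Real.exp (-t) ^ k * Real.exp t ^ (n - k) * n.choose k) := by
        refine Finset.sum_le_sum fun k hk => ?_
        have hk : k ≤ d := Finset.mem_Iic.1 hk
        have hk' : (k : ℝ) ≤ d := by exact_mod_cast hk
        have h1 : Real.exp (t * (2 * d - n)) * (Real.exp (-t) ^ k * Real.exp t ^ (n - k)) =
            Real.exp (t * (2 * (d - k))) := by
          rw [← Real.exp_nat_mul, ← Real.exp_nat_mul, ← Real.exp_add, ← Real.exp_add,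
            Nat.cast_sub (by omega)]
          ring_nf
        rw [← mul_assoc, h1]
        exact le_mul_of_one_le_left (by positivity)
          (Real.one_le_exp (mul_nonneg ht0 (by linarith)))
    _ ≤ ∑ k ∈ Finset.range (n + 1),
          Real.exp (t * (2 * d - n)) * (Real.exp (-t) ^ k * Real.exp t ^ (n - k) * n.choose k) := by
        refine Finset.sum_le_sum_of_subset_of_nonneg (fun k hk => ?_) fun k _ _ => by positivity
        have := Finset.mem_Iic.1 hk
        exact Finset.mem_range.2 (by omega)
    _ = Real.exp (t * (2 * d - n)) * (2 ^ n * Real.cosh t ^ n) := by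
        rw [← Finset.mul_sum, ← add_pow, ← mul_pow, Real.cosh_eq]
        ring_nf
    _ ≤ Real.exp (t * (2 * d - n)) * (2 ^ n * Real.exp (t ^ 2 / 2) ^ n) := by
        gcongr
        exact Real.cosh_le_exp_half_sq t
    _ = 2 ^ n * Real.exp (-((n : ℝ) - 2 * d) ^ 2 / (2 * n)) := by
        rw [← Real.exp_nat_mul, mul_left_comm, ← Real.exp_add]
        congr 2
        rw [ht]
        field_simp
        ring

/-- If the law of `x` is invariant under sign changes of the vectors `x i`, then all of them lie
in a common open half-space with probability at most the binomial lower tail. -/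
lemma two_pow_mul_measure_halfspace_le {Ω ι κ : Type*} [Fintype ι] [DecidableEq ι] [Fintype κ]
    [MeasurableSpace Ω] (μ : Measure Ω) [IsProbabilityMeasure μ] {x : Ω → ι → κ → ℝ}
    (hx : Measurable x) (T : Finset ι → Ω → Ω) (hT : ∀ s, MeasurePreserving (T s) μ μ)
    (hTx : ∀ s ω i, x (T s ω) i = (if i ∈ s then 1 else -1 : ℝ) • x ω i) :
    2 ^ Fintype.card ι * μ {ω | ∃ δ : κ → ℝ, ∀ i, 0 < x ω i ⬝ᵥ δ} ≤
      ∑ k ∈ Finset.Iic (Fintype.card κ), ((Fintype.card ι).choose k : ENNReal) := by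
  classical
  set A : Set Ω := {ω | ∃ δ : κ → ℝ, ∀ i, 0 < x ω i ⬝ᵥ δ} with hA
  have hAm : MeasurableSet A := by
    have hopen : IsOpen {y : ι → κ → ℝ | ∃ δ : κ → ℝ, ∀ i, 0 < y i ⬝ᵥ δ} := by
      simp only [Set.ofPred_exists, Set.ofPred_forall]
      exact isOpen_iUnion fun δ => isOpen_iInter_of_finite fun i =>
        isOpen_lt continuous_const (by fun_prop)
    exact hx hopen.measurableSet
  calc 2 ^ Fintype.card ι * μ A = ∑ s : Finset ι, μ (T s ⁻¹' A) := by
        simp [fun s => (hT s).measure_preimage hAm.nullMeasurableSet]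
    _ = ∫⁻ ω, ∑ s : Finset ι, (T s ⁻¹' A).indicator 1 ω ∂μ := by
        rw [lintegral_finsetSum _ fun s _ =>
          measurable_one.indicator ((hT s).measurable hAm)]
        simp [fun s => lintegral_indicator_one (μ := μ) ((hT s).measurable hAm)]
    _ ≤ ∫⁻ _, ∑ k ∈ Finset.Iic (Fintype.card κ), ((Fintype.card ι).choose k : ENNReal) ∂μ := by
        refine lintegral_mono fun ω => ?_
        have hcard : ∑ s : Finset ι, (T s ⁻¹' A).indicator (1 : Ω → ENNReal) ω =
            (signPatterns (x ω)).card := by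
          simp only [Set.indicator_apply, Set.mem_preimage, hA, Set.mem_ofPred_eq, hTx,
            smul_dotProduct, smul_eq_mul, Pi.one_apply, signPatterns, Finset.sum_boole]
        simp only [hcard]
        exact_mod_cast card_signPatterns_le (x ω)
    _ = _ := by simp

lemma measure_halfspace_le_exp {Ω ι κ : Type*} [Fintype ι] [DecidableEq ι] [Fintype κ]
    [MeasurableSpace Ω] (μ : Measure Ω) [IsProbabilityMeasure μ] {x : Ω → ι → κ → ℝ}
    (hx : Measurable x) (T : Finset ι → Ω → Ω) (hT : ∀ s, MeasurePreserving (T s) μ μ)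
    (hTx : ∀ s ω i, x (T s ω) i = (if i ∈ s then 1 else -1 : ℝ) • x ω i)
    {n d : ℕ} (hn : Fintype.card ι = n) (hd : Fintype.card κ = d) (hn0 : 0 < n)
    (hdn : 2 * d ≤ n) :
    μ {ω | ∃ δ : κ → ℝ, ∀ i, 0 < x ω i ⬝ᵥ δ} ≤
      ENNReal.ofReal (Real.exp (-((n : ℝ) - 2 * d) ^ 2 / (2 * n))) := by
  have h := two_pow_mul_measure_halfspace_le μ hx T hT hTx
  rw [hn, hd] at h
  have hsum : ∑ k ∈ Finset.Iic d, (n.choose k : ENNReal) ≤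
      2 ^ n * ENNReal.ofReal (Real.exp (-((n : ℝ) - 2 * d) ^ 2 / (2 * n))) := by
    have h2 := ENNReal.ofReal_le_ofReal (sum_choose_le_two_pow_mul_exp hn0 hdn)
    rw [ENNReal.ofReal_mul (by positivity), ENNReal.ofReal_pow (by positivity),
      ENNReal.ofReal_sum_of_nonneg fun _ _ => by positivity] at h2
    simpa using h2
  exact (ENNReal.mul_le_mul_iff_right (by simp) (by simp)).1 (h.trans hsum)

instance (L K : ℕ) : IsProbabilityMeasure (gaussM L K) := by
  unfold gaussM; infer_instance

lemma measurePreserving_gaussM_mul {L K : ℕ} (ε : Fin L → Fin K → ℝ) (hε : ∀ i j, ε i j ^ 2 = 1) :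
    MeasurePreserving (fun B i j => ε i j * B i j) (gaussM L K) (gaussM L K) := by
  refine measurePreserving_pi _ _ (f := fun i (b : Fin K → ℝ) j => ε i j * b j) fun i =>
    measurePreserving_pi _ _ (f := fun j t => ε i j * t) fun j => ⟨by fun_prop, ?_⟩
  rw [gaussianReal_map_const_mul]
  congr 1
  · simp
  · ext
    simp [hε]

/-- Changes the sign of the first entry of each row outside `s`. -/
def flipHead {L K : ℕ} (s : Finset (Fin L)) (B : Fin L → Fin (K + 1) → ℝ) :
    Fin L → Fin (K + 1) → ℝ :=
  fun i j => (if j = 0 ∧ i ∉ s then -1 else 1) * B i j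

lemma measurePreserving_flipHead {L K : ℕ} (s : Finset (Fin L)) :
    MeasurePreserving (flipHead s) (gaussM L (K + 1)) (gaussM L (K + 1)) :=
  measurePreserving_gaussM_mul (fun i j => if j = 0 ∧ i ∉ s then -1 else 1) fun i j => by
    split_ifs <;> norm_num

lemma flipHead_succ_div_zero {L K : ℕ} (s : Finset (Fin L)) (B : Fin L → Fin (K + 1) → ℝ)
    (i : Fin L) (j : Fin K) :
    flipHead s B i j.succ / flipHead s B i 0 =
      (if i ∈ s then 1 else -1) * (B i j.succ / B i 0) := by
  by_cases h : i ∈ s <;> simp [flipHead, h, div_neg]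

lemma sq_sub_div_two_mul_le_succ {n d : ℝ} (hd : 0 ≤ d) (hn : 2 * d ≤ n) :
    (n - 2 * d) ^ 2 / (2 * n) ≤ (n + 1 - 2 * d) ^ 2 / (2 * (n + 1)) := by
  rcases (by linarith : 0 ≤ n).eq_or_lt with rfl | hpos
  · simp
    positivity
  · rw [div_le_div_iff₀ (by positivity) (by positivity)]
    nlinarith [mul_nonneg (sub_nonneg.2 hn) (by linarith : 0 ≤ n + 2 * d)]

/-- Here the ambient dimensions are `K+1` and `N+1` (so the paper's `K`, `N` are `K+1`,
`N+1`, the tails `b̃ℓ ∈ ℝ^K`, `c̃ℓ ∈ ℝ^N`, and `N+K-2` becomes `N+K`).  If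
`L - 1 ≥ 2(N+K)` then with probability at least
`1 - exp(-[(L-1) - 2(N+K)]²/(2(L-1)))` every `(δh̃, δm̃)` admits an `ℓ` with
`⟨c̃ℓ/cℓ1, δm̃⟩ + ⟨b̃ℓ/bℓ1, δh̃⟩ ≤ 0`. -/
theorem stmt10 {K N L : ℕ} (hL : 2 * (N + K) + 1 ≤ L) :
    ENNReal.ofReal
        (1 - Real.exp (-(((L : ℝ) - 1) - 2 * ((N : ℝ) + K)) ^ 2 / (2 * ((L : ℝ) - 1)))) ≤
      (Measure.prod (gaussM L (K + 1)) (gaussM L (N + 1)))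
        {p | ∀ (δh : Fin K → ℝ) (δm : Fin N → ℝ), ∃ ℓ,
          (∑ j, p.2 ℓ j.succ / p.2 ℓ 0 * δm j) +
            (∑ i, p.1 ℓ i.succ / p.1 ℓ 0 * δh i) ≤ 0} := by
  classical
  set μ := (gaussM L (K + 1)).prod (gaussM L (N + 1))
  let x : (Fin L → Fin (K + 1) → ℝ) × (Fin L → Fin (N + 1) → ℝ) → Fin L → Fin N ⊕ Fin K → ℝ :=
    fun p l => Sum.elim (fun j => p.2 l j.succ / p.2 l 0) (fun i => p.1 l i.succ / p.1 l 0)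
  have hx : Measurable x := by
    refine measurable_pi_lambda _ fun l => measurable_pi_lambda _ fun j => ?_
    rcases j with j | j <;> simp only [x, Sum.elim_inl, Sum.elim_inr] <;> fun_prop
  have hbad := measure_halfspace_le_exp μ hx (fun s => Prod.map (flipHead s) (flipHead s))
    (fun s => (measurePreserving_flipHead s).prod (measurePreserving_flipHead s))
    (fun s p l => by ext (j | j) <;> simp [x, flipHead_succ_div_zero])
    (Fintype.card_fin L) (by simp : Fintype.card (Fin N ⊕ Fin K) = N + K) (by omega) (by omega)
  set good : Set ((Fin L → Fin (K + 1) → ℝ) × (Fin L → Fin (N + 1) → ℝ)) := {p | _}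
  set bad : Set ((Fin L → Fin (K + 1) → ℝ) × (Fin L → Fin (N + 1) → ℝ)) := {p | _}
  have hcover : Set.univ ⊆ good ∪ bad := fun p _ => by
    by_contra hp
    simp only [good, bad, Set.mem_union, Set.mem_ofPred_eq, not_or] at hp
    obtain ⟨hgood, hnbad⟩ := hp
    push Not at hgood
    obtain ⟨δh, δm, h⟩ := hgood
    exact hnbad ⟨Sum.elim δm δh, fun l => by
      simpa [x, dotProduct, Fintype.sum_sum_type] using h l⟩
  have hone : 1 ≤ μ good + μ bad := by
    rw [← measure_univ (μ := μ)]
    exact (measure_mono hcover).trans (measure_union_le _ _)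
  have hexp : Real.exp (-((L : ℝ) - 2 * ((N + K : ℕ) : ℝ)) ^ 2 / (2 * L)) ≤
      Real.exp (-(((L : ℝ) - 1) - 2 * ((N : ℝ) + K)) ^ 2 / (2 * ((L : ℝ) - 1))) := by
    have hL' : 2 * ((N : ℝ) + K) + 1 ≤ L := by exact_mod_cast hL
    have h := sq_sub_div_two_mul_le_succ (n := (L : ℝ) - 1) (d := (N : ℝ) + K)
      (by positivity) (by linarith)
    rw [sub_add_cancel] at h
    rw [Real.exp_le_exp, neg_div, neg_div, Nat.cast_add]
    exact neg_le_neg h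
  rw [ENNReal.ofReal_sub _ (Real.exp_pos _).le, ENNReal.ofReal_one, tsub_le_iff_right]
  exact hone.trans (by gcongr; exact hbad.trans (ENNReal.ofReal_le_ofReal hexp))
end

section
/- Let B ∈ ℝ^{L×K} and C ∈ ℝ^{L×N} have independent standard Gaussian N(0,1) entries, with ℓ-th rows bℓᵀ and cℓᵀ. There exist absolute constants C₀ > 0 and c > 0 such that if L ≥ C₀(K+N) then, with probability at least 1 − e^{−cL}, min over x ∈ S^{K−1} and y ∈ S^{N−1} of Σ_{ℓ=1}^{L} 1{bℓᵀx ≤ 0}·1{cℓᵀy ≤ 0} ≥ 0.2·L. -/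
open MeasureTheory ProbabilityTheory

/-- The sets of indices `l` on which some linear form is positive at the vectors `v l`. -/
noncomputable def positivePatterns {ι κ : Type*} [Fintype ι] [Fintype κ] (v : ι → κ → ℝ) :
    Finset (Finset ι) := by
  classical
  exact Finset.univ.filter fun A => ∃ x : κ → ℝ, ∀ l, l ∈ A ↔ 0 < ∑ i, v l i * x i

lemma mem_positivePatterns {ι κ : Type*} [Fintype ι] [Fintype κ] {v : ι → κ → ℝ}
    {A : Finset ι} :
    A ∈ positivePatterns v ↔ ∃ x : κ → ℝ, ∀ l, l ∈ A ↔ 0 < ∑ i, v l i * x i := by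
  simp [positivePatterns]

/-- No set carrying a linear relation with a positive coefficient is shattered by the
positivity patterns. -/
lemma not_exists_pos_of_shatters {ι κ : Type*} [Fintype ι] [Fintype κ] [DecidableEq ι]
    {v : ι → κ → ℝ} {s : Finset ι} (hs : (positivePatterns v).Shatters s) {g : s → ℝ}
    (hg : ∑ l, g l • v l = 0) (l : s) : g l ≤ 0 := by
  classical
  by_contra! hl
  obtain ⟨A, hA, hAs⟩ := hs (Finset.filter_subset (fun l => ∃ h : l ∈ s, 0 < g ⟨l, h⟩) s)
  obtain ⟨x, hx⟩ := mem_positivePatterns.1 hA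
  have hiff (m : s) : 0 < g m ↔ 0 < ∑ i, v m i * x i := by
    have := congrArg ((m : ι) ∈ ·) hAs
    simpa [m.2, hx] using this.symm
  have hsum : ∑ m : s, g m * ∑ i, v m i * x i = 0 := by
    have h0 : ∑ i, (∑ m : s, g m • v m) i * x i = 0 := by rw [hg]; simp
    rw [← h0]
    simp only [Finset.sum_apply, Pi.smul_apply, smul_eq_mul, Finset.sum_mul, Finset.mul_sum,
      mul_assoc]
    exact Finset.sum_comm
  have hpos : 0 < ∑ m : s, g m * ∑ i, v m i * x i := by
    refine Finset.sum_pos' (fun m _ => ?_) ⟨l, Finset.mem_univ _, mul_pos hl ((hiff l).1 hl)⟩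
    rcases lt_or_ge 0 (g m) with h | h
    · exact (mul_pos h ((hiff m).1 h)).le
    · exact mul_nonneg_of_nonpos_of_nonpos h (not_lt.1 fun h' => h.not_gt ((hiff m).2 h'))
  exact hpos.ne' hsum

lemma card_le_of_shatters_positivePatterns {ι κ : Type*} [Fintype ι] [Fintype κ]
    [DecidableEq ι] {v : ι → κ → ℝ} {s : Finset ι} (hs : (positivePatterns v).Shatters s) :
    s.card ≤ Fintype.card κ := by
  have hli : LinearIndependent ℝ fun l : s => v l := by
    refine Fintype.linearIndependent_iff.2 fun g hg l => le_antisymm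
      (not_exists_pos_of_shatters hs hg l) ?_
    have := not_exists_pos_of_shatters hs (g := -g)
      (by simp only [Pi.neg_apply, neg_smul, Finset.sum_neg_distrib, hg, neg_zero]) l
    simpa using this
  simpa using hli.fintype_card_le_finrank

/-- A Sauer-Shelah bound on the number of positivity patterns. -/
lemma card_positivePatterns_mul_pow_le {ι κ : Type*} [Fintype ι] [Fintype κ]
    (v : ι → κ → ℝ) {t : ℝ} (ht₀ : 0 ≤ t) (ht₁ : t ≤ 1) :
    ((positivePatterns v).card : ℝ) * t ^ Fintype.card κ ≤ (1 + t) ^ Fintype.card ι := by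
  classical
  calc ((positivePatterns v).card : ℝ) * t ^ Fintype.card κ
      ≤ ((positivePatterns v).shatterer.card : ℝ) * t ^ Fintype.card κ := by
        refine mul_le_mul_of_nonneg_right ?_ (by positivity)
        exact_mod_cast Finset.card_le_card_shatterer (positivePatterns v)
    _ = ∑ _s ∈ (positivePatterns v).shatterer, t ^ Fintype.card κ := by simp
    _ ≤ ∑ s ∈ (positivePatterns v).shatterer, t ^ s.card := by
        refine Finset.sum_le_sum fun s hs => pow_le_pow_of_le_one ht₀ ht₁ ?_
        exact card_le_of_shatters_positivePatterns (Finset.mem_shatterer.1 hs)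
    _ ≤ ∑ s : Finset ι, t ^ s.card :=
        Finset.sum_le_sum_of_subset_of_nonneg (Finset.subset_univ _) fun _ _ _ => by positivity
    _ = (1 + t) ^ Fintype.card ι := by
        simpa [add_comm] using Fintype.sum_pow_mul_eq_add_pow ι t (1 : ℝ)

lemma exp_log_four_thirds_mul_le :
    Real.exp (Real.log (4 / 3) * 0.2) * (15 / 16) ≤ Real.exp (-0.0065) := by
  refine le_of_pow_le_pow_left₀ (n := 5) (by norm_num) (by positivity) ?_
  rw [mul_pow, ← Real.exp_nat_mul, ← Real.exp_nat_mul]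
  have h : ((5 : ℕ) : ℝ) * (Real.log (4 / 3) * 0.2) = Real.log (4 / 3) := by push_cast; ring
  rw [h, Real.exp_log (by norm_num)]
  have := Real.add_one_le_exp (((5 : ℕ) : ℝ) * (-0.0065))
  norm_num at this ⊢
  linarith

/-- A Chernoff bound: few functions into a four-element set agree with a given one in fewer
than a fifth of the places. -/
lemma card_few_agreements_le {ι α : Type*} [Fintype ι] [DecidableEq ι] [Fintype α]
    [DecidableEq α] (hα : Fintype.card α = 4) (τ : ι → α) :
    ((Finset.univ.filter fun ω : ι → α =>
      ((Finset.univ.filter fun l => ω l = τ l).card : ℝ) < 0.2 * Fintype.card ι).card : ℝ) ≤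
      4 ^ Fintype.card ι * Real.exp (-0.0065 * Fintype.card ι) := by
  set n := Fintype.card ι
  set θ := Real.log (4 / 3)
  have hθ : 0 < θ := Real.log_pos (by norm_num)
  have hexp : Real.exp (-θ) = 3 / 4 := by
    rw [Real.exp_neg, Real.exp_log (by norm_num)]; norm_num
  have hweight (ω : ι → α) :
      ∏ l, (if ω l = τ l then (3 / 4 : ℝ) else 1) =
        Real.exp (-θ * (Finset.univ.filter fun l => ω l = τ l).card) := by
    rw [Finset.prod_ite, Finset.prod_const, Finset.prod_const_one, mul_one, ← hexp,
      ← Real.exp_nat_mul, mul_comm]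
  have htotal : ∑ ω : ι → α, ∏ l, (if ω l = τ l then (3 / 4 : ℝ) else 1) = (15 / 4) ^ n := by
    have := Finset.sum_prod_piFinset (Finset.univ : Finset α)
      fun (l : ι) a => if a = τ l then (3 / 4 : ℝ) else 1
    rw [Fintype.piFinset_univ] at this
    rw [this]
    have hcol (l : ι) : ∑ a, (if a = τ l then (3 / 4 : ℝ) else 1) = 15 / 4 := by
      have (a : α) : (if a = τ l then (3 / 4 : ℝ) else 1) =
          1 - if a = τ l then (1 / 4 : ℝ) else 0 := by
        split_ifs <;> norm_num
      simp only [this, Finset.sum_sub_distrib, Finset.sum_ite_eq', Finset.mem_univ, if_true,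
        Finset.sum_const, Finset.card_univ, hα]
      norm_num
    simp only [hcol, Finset.prod_const, Finset.card_univ, n]
  calc _ = ∑ ω ∈ Finset.univ.filter fun ω : ι → α =>
        ((Finset.univ.filter fun l => ω l = τ l).card : ℝ) < 0.2 * n, (1 : ℝ) := by simp
    _ ≤ ∑ ω ∈ Finset.univ.filter fun ω : ι → α =>
        ((Finset.univ.filter fun l => ω l = τ l).card : ℝ) < 0.2 * n,
        Real.exp (θ * 0.2 * n) * ∏ l, (if ω l = τ l then (3 / 4 : ℝ) else 1) := by
        refine Finset.sum_le_sum fun ω hω => ?_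
        rw [hweight, ← Real.exp_add, Real.one_le_exp_iff]
        have := (Finset.mem_filter.1 hω).2
        nlinarith
    _ ≤ ∑ ω : ι → α,
        Real.exp (θ * 0.2 * n) * ∏ l, (if ω l = τ l then (3 / 4 : ℝ) else 1) :=
        Finset.sum_le_sum_of_subset_of_nonneg (Finset.subset_univ _) fun ω _ _ => by
          rw [hweight]; positivity
    _ = 4 ^ n * (Real.exp (θ * 0.2) * (15 / 16)) ^ n := by
        rw [← Finset.mul_sum, htotal, mul_comm (θ * 0.2), Real.exp_nat_mul, ← mul_pow, ← mul_pow]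
        ring
    _ ≤ 4 ^ n * Real.exp (-0.0065) ^ n := by
        gcongr
        exact exp_log_four_thirds_mul_le
    _ = _ := by rw [← Real.exp_nat_mul, mul_comm (n : ℝ)]

/-- Negate the rows selected by `s`. -/
def flipRows {ι κ : Type*} (s : ι → Bool) (v : ι → κ → ℝ) : ι → κ → ℝ :=
  fun l i => if s l then -v l i else v l i

lemma sum_flipRows_nonpos {ι κ : Type*} [Fintype κ] {s : ι → Bool} {v : ι → κ → ℝ}
    {x : κ → ℝ} {l : ι} (h : s l = true ↔ 0 < ∑ i, v l i * x i) :
    ∑ i, flipRows s v l i * x i ≤ 0 := by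
  cases hs : s l
  · simpa [flipRows, hs] using h
  · simpa [flipRows, hs, neg_mul, Finset.sum_neg_distrib] using (h.1 hs).le

/-- The number of rows at which both linear forms are nonpositive. -/
noncomputable def jointCount {ι κ ν : Type*} [Fintype ι] [Fintype κ] [Fintype ν]
    (p : (ι → κ → ℝ) × (ι → ν → ℝ)) (x : κ → ℝ) (y : ν → ℝ) : ℝ :=
  ∑ l, if (∑ i, p.1 l i * x i) ≤ 0 ∧ (∑ j, p.2 l j * y j) ≤ 0 then (1 : ℝ) else 0

/-- The matrix pairs for which some pair of vectors has a joint count below a fifth. -/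
def lowCountSet (ι κ ν : Type*) [Fintype ι] [Fintype κ] [Fintype ν] :
    Set ((ι → κ → ℝ) × (ι → ν → ℝ)) :=
  {p | ∃ x y, jointCount p x y < 0.2 * Fintype.card ι}

lemma isOpen_lowCountSet (ι κ ν : Type*) [Fintype ι] [Fintype κ] [Fintype ν] :
    IsOpen (lowCountSet ι κ ν) := by
  have h (x : κ → ℝ) (y : ν → ℝ) :
      UpperSemicontinuous fun p : (ι → κ → ℝ) × (ι → ν → ℝ) => jointCount p x y := by
    refine upperSemicontinuous_sum fun l _ => ?_
    have hc : IsClosed {p : (ι → κ → ℝ) × (ι → ν → ℝ) |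
        (∑ i, p.1 l i * x i) ≤ 0 ∧ (∑ j, p.2 l j * y j) ≤ 0} := by
      have h₁ : IsClosed {p : (ι → κ → ℝ) × (ι → ν → ℝ) | (∑ i, p.1 l i * x i) ≤ 0} :=
        isClosed_le (by fun_prop) (by fun_prop)
      have h₂ : IsClosed {p : (ι → κ → ℝ) × (ι → ν → ℝ) | (∑ j, p.2 l j * y j) ≤ 0} :=
        isClosed_le (by fun_prop) (by fun_prop)
      exact h₁.inter h₂
    convert! hc.upperSemicontinuous_indicator (zero_le_one (α := ℝ)) using 2 with p
    simp [Set.indicator_apply]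
  simp only [lowCountSet, Set.ofPred_exists]
  exact isOpen_iUnion fun x => isOpen_iUnion fun y => (h x y).isOpen_preimage _

/-- Negate the rows of a matrix pair according to a pair of sign patterns. -/
def flipPair {ι κ ν : Type*} (ω : ι → Bool × Bool) :
    (ι → κ → ℝ) × (ι → ν → ℝ) → (ι → κ → ℝ) × (ι → ν → ℝ) :=
  Prod.map (flipRows fun l => (ω l).1) (flipRows fun l => (ω l).2)

open Classical in
lemma card_flipPair_mem_lowCountSet_le {ι κ ν : Type*} [Fintype ι] [DecidableEq ι]
    [Fintype κ] [Fintype ν] (p : (ι → κ → ℝ) × (ι → ν → ℝ)) :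
    ((Finset.univ.filter fun ω => flipPair ω p ∈ lowCountSet ι κ ν).card : ℝ) ≤
      (positivePatterns p.1).card * (positivePatterns p.2).card *
        (4 ^ Fintype.card ι * Real.exp (-0.0065 * Fintype.card ι)) := by
  let τ : Finset ι × Finset ι → ι → Bool × Bool :=
    fun A l => (decide (l ∈ A.1), decide (l ∈ A.2))
  let few : Finset ι × Finset ι → Finset (ι → Bool × Bool) := fun A =>
    Finset.univ.filter fun ω =>
      ((Finset.univ.filter fun l => ω l = τ A l).card : ℝ) < 0.2 * Fintype.card ι
  have hsub : (Finset.univ.filter fun ω => flipPair ω p ∈ lowCountSet ι κ ν) ⊆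
      (positivePatterns p.1 ×ˢ positivePatterns p.2).biUnion few := by
    intro ω hω
    obtain ⟨x, y, hxy⟩ := (Finset.mem_filter.1 hω).2
    refine Finset.mem_biUnion.2 ⟨(Finset.univ.filter fun l => 0 < ∑ i, p.1 l i * x i,
      Finset.univ.filter fun l => 0 < ∑ j, p.2 l j * y j), Finset.mem_product.2
        ⟨mem_positivePatterns.2 ⟨x, by simp⟩, mem_positivePatterns.2 ⟨y, by simp⟩⟩,
      Finset.mem_filter.2 ⟨Finset.mem_univ _, lt_of_le_of_lt ?_ hxy⟩⟩
    rw [jointCount, Finset.sum_boole]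
    gcongr with l
    intro hl
    simp only [τ, Finset.mem_filter, Finset.mem_univ, true_and, Prod.ext_iff] at hl
    exact ⟨sum_flipRows_nonpos (s := fun l => (ω l).1) (by simp [hl.1]),
      sum_flipRows_nonpos (s := fun l => (ω l).2) (by simp [hl.2])⟩
  calc _ ≤ (((positivePatterns p.1 ×ˢ positivePatterns p.2).biUnion few).card : ℝ) := by
        exact_mod_cast Finset.card_le_card hsub
    _ ≤ ∑ A ∈ positivePatterns p.1 ×ˢ positivePatterns p.2, ((few A).card : ℝ) := by
        exact_mod_cast Finset.card_biUnion_le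
    _ ≤ ∑ _A ∈ positivePatterns p.1 ×ˢ positivePatterns p.2,
        (4 ^ Fintype.card ι * Real.exp (-0.0065 * Fintype.card ι) : ℝ) :=
        Finset.sum_le_sum fun A _ => card_few_agreements_le (by simp) (τ A)
    _ = _ := by simp [Finset.card_product]

lemma measurePreserving_flipRows {L K : ℕ} (s : Fin L → Bool) :
    MeasurePreserving (flipRows s) (gaussM L K) (gaussM L K) := by
  have hsign (b : Bool) : MeasurePreserving (fun a : ℝ => if b then -a else a)
      (gaussianReal 0 1) (gaussianReal 0 1) := by
    cases b
    · simpa using! MeasurePreserving.id (gaussianReal 0 1)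
    · simpa using (⟨measurable_neg, by simpa using gaussianReal_map_neg (μ := 0) (v := 1)⟩ :
        MeasurePreserving (fun a : ℝ => -a) (gaussianReal 0 1) (gaussianReal 0 1))
  exact measurePreserving_pi _ _ fun l => measurePreserving_pi _ _ fun _ => hsign (s l)

lemma measurePreserving_flipPair {L K N : ℕ} (ω : Fin L → Bool × Bool) :
    MeasurePreserving (flipPair ω) ((gaussM L K).prod (gaussM L N))
      ((gaussM L K).prod (gaussM L N)) :=
  (measurePreserving_flipRows _).prod (measurePreserving_flipRows _)

/-- Averaging over a finite family of measure-preserving maps. -/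
lemma card_mul_measure_le {Ω α : Type*} [Fintype Ω] [MeasurableSpace α] {μ : Measure α}
    [IsProbabilityMeasure μ] {T : Ω → α → α} (hT : ∀ ω, MeasurePreserving (T ω) μ μ)
    {E : Set α} (hE : MeasurableSet E) [∀ p, DecidablePred fun ω => T ω p ∈ E] {b : ENNReal}
    (hb : ∀ p, ((Finset.univ.filter fun ω => T ω p ∈ E).card : ENNReal) ≤ b) :
    (Fintype.card Ω : ENNReal) * μ E ≤ b := by
  calc (Fintype.card Ω : ENNReal) * μ E = ∑ ω, ∫⁻ p, (T ω ⁻¹' E).indicator 1 p ∂μ := by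
        simp [lintegral_indicator_one ((hT _).measurable hE),
          (hT _).measure_preimage hE.nullMeasurableSet]
    _ = ∫⁻ p, ∑ ω, (T ω ⁻¹' E).indicator 1 p ∂μ :=
        (lintegral_finsetSum _ fun ω _ =>
          measurable_one.indicator ((hT ω).measurable hE)).symm
    _ ≤ ∫⁻ _, b ∂μ := lintegral_mono fun p => by
        refine le_of_eq_of_le ?_ (hb p)
        rw [← Finset.sum_boole]
        exact Finset.sum_congr rfl fun ω _ => by by_cases h : T ω p ∈ E <;> simp [h]
    _ = b := by simp

/-- The pattern count in exponential form. -/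
lemma card_positivePatterns_le_exp {L K : ℕ} (v : Fin L → Fin K → ℝ) :
    ((positivePatterns v).card : ℝ) ≤ Real.exp (7 * K + 0.001 * L) := by
  have hsmall : Real.exp (-7) ≤ 0.001 := by
    rw [Real.exp_neg, inv_le_comm₀ (by positivity) (by norm_num)]
    have h : Real.exp 7 = Real.exp 1 ^ 7 := by rw [← Real.exp_nat_mul]; norm_num
    rw [h]
    refine le_trans ?_ (pow_le_pow_left₀ (by norm_num : (0 : ℝ) ≤ 2.71)
      (le_trans (by norm_num) Real.exp_one_gt_d9.le) 7)
    norm_num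
  have h := card_positivePatterns_mul_pow_le v (Real.exp_pos (-7)).le (hsmall.trans (by norm_num))
  simp only [Fintype.card_fin] at h
  have hone : (1 + Real.exp (-7)) ^ L ≤ Real.exp (0.001 * L) := by
    rw [mul_comm, Real.exp_nat_mul]
    refine pow_le_pow_left₀ (by positivity) ?_ L
    linarith [Real.add_one_le_exp (0.001 : ℝ)]
  rw [← Real.exp_nat_mul, ← le_div_iff₀ (by positivity), div_eq_mul_inv, ← Real.exp_neg] at h
  refine h.trans ((mul_le_mul_of_nonneg_right hone (by positivity)).trans_eq ?_)
  rw [← Real.exp_add]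
  ring_nf

lemma measure_lowCountSet_le {K N L : ℕ} (hL : 7000 * ((K : ℝ) + N) ≤ L) :
    ((gaussM L K).prod (gaussM L N)) (lowCountSet (Fin L) (Fin K) (Fin N)) ≤
      ENNReal.ofReal (Real.exp (-0.003 * L)) := by
  classical
  have h := card_mul_measure_le (μ := (gaussM L K).prod (gaussM L N))
    (T := fun ω : Fin L → Bool × Bool => flipPair ω) measurePreserving_flipPair
    (isOpen_lowCountSet (Fin L) (Fin K) (Fin N)).measurableSet
    (b := ENNReal.ofReal (4 ^ L * Real.exp (-0.003 * L))) fun p => by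
      rw [← ENNReal.ofReal_natCast]
      refine ENNReal.ofReal_le_ofReal ((card_flipPair_mem_lowCountSet_le p).trans ?_)
      rw [Fintype.card_fin]
      calc _ ≤ Real.exp (7 * K + 0.001 * L) * Real.exp (7 * N + 0.001 * L) *
            (4 ^ L * Real.exp (-0.0065 * L)) := by
            refine mul_le_mul_of_nonneg_right (mul_le_mul (card_positivePatterns_le_exp _)
              (card_positivePatterns_le_exp _) (by positivity) (by positivity)) (by positivity)
        _ = 4 ^ L * Real.exp (7 * K + 0.001 * L + (7 * N + 0.001 * L) + -0.0065 * L) := by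
            simp only [Real.exp_add]; ring
        _ ≤ _ := by
            gcongr
            linarith
  have hcard : (Fintype.card (Fin L → Bool × Bool) : ENNReal) = ENNReal.ofReal (4 ^ L) := by
    rw [ENNReal.ofReal_pow (by norm_num)]
    simp
  rwa [hcard, ENNReal.ofReal_mul (by positivity), ENNReal.mul_le_mul_iff_right
    (by simp) ENNReal.ofReal_ne_top] at h

/-- With high probability, for every pair of unit vectors `(x, y)` at least `0.2·L` of
the indices `ℓ` satisfy `bℓᵀx ≤ 0` and `cℓᵀy ≤ 0` simultaneously. -/
theorem stmt12 :
    ∃ C₀ c : ℝ, 0 < C₀ ∧ 0 < c ∧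
      ∀ (K N L : ℕ), C₀ * (K + N) ≤ (L : ℝ) →
        ENNReal.ofReal (1 - Real.exp (-c * L)) ≤
          (Measure.prod (gaussM L K) (gaussM L N))
            {p | ∀ (x : EuclideanSpace ℝ (Fin K)) (y : EuclideanSpace ℝ (Fin N)),
              ‖x‖ = 1 → ‖y‖ = 1 →
              0.2 * L ≤ ∑ ℓ, (if (∑ i, p.1 ℓ i * x i) ≤ 0 ∧ (∑ j, p.2 ℓ j * y j) ≤ 0
                then (1 : ℝ) else 0)} := by
  refine ⟨7000, 0.003, by norm_num, by norm_num, fun K N L hL => ?_⟩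
  set μ := Measure.prod (gaussM L K) (gaussM L N)
  rw [ENNReal.ofReal_sub _ (Real.exp_pos _).le, ENNReal.ofReal_one]
  calc (1 : ENNReal) - ENNReal.ofReal (Real.exp (-0.003 * L))
      ≤ 1 - μ (lowCountSet (Fin L) (Fin K) (Fin N)) :=
        tsub_le_tsub_left (measure_lowCountSet_le hL) 1
    _ = μ (lowCountSet (Fin L) (Fin K) (Fin N))ᶜ :=
        (prob_compl_eq_one_sub (isOpen_lowCountSet _ _ _).measurableSet).symm
    _ ≤ _ := by
        refine measure_mono fun p hp => ?_
        intro x y _ _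
        simpa [jointCount] using not_lt.1 fun h => hp ⟨x, y, h⟩
end
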